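/- arXiv:1608.01597 — 2 statements merged into one kernel-verified Lean document; each statement's English description precedes it below -/
import Mathlib

section
/- Fix β > 0 and integers k ≥ 1. Let p be a symmetric polynomial in k real variables of total degree d. Then there exists a symmetric polynomial q in k+1 real variables of total degree at most d such that for every strictly increasing x = (x_1 < x_2 < … < x_{k+1}) ∈ ℝ^{k+1}, ∫_{W^{(k)}(x)} Λ^{(k)}(x,y) p(y) dy = q(x). In particular, the Dixon–Anderson kernel maps symmetric polynomials in k variables to symmetric polynomials in k+1 variables without increasing the degree. -/
open Finset MeasureTheory

/-- First-order partial derivative `∂f/∂z_i (z)`. -/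
noncomputable def pd {m : ℕ} (f : (Fin m → ℝ) → ℝ) (i : Fin m) (z : Fin m → ℝ) : ℝ :=
  fderiv ℝ f z (Pi.single i 1)

/-- Second-order partial derivative `∂²f/∂z_i² (z)`. -/
noncomputable def pd2 {m : ℕ} (f : (Fin m → ℝ) → ℝ) (i : Fin m) (z : Fin m → ℝ) : ℝ :=
  fderiv ℝ (fun w => fderiv ℝ f w (Pi.single i 1)) z (Pi.single i 1)

/-- The generator `A^{(m)}` of the `m`-dimensional `β`-Dyson Brownian motion, with `θ = β/2`:
`(A^{(m)}f)(z) = (1/2) Σ_i ∂²f/∂z_i²(z) + θ Σ_i Σ_{j≠i} (1/(z_i-z_j)) ∂f/∂z_i(z)`. -/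
noncomputable def genA {m : ℕ} (θ : ℝ) (f : (Fin m → ℝ) → ℝ) (z : Fin m → ℝ) : ℝ :=
  (1 / 2) * ∑ i, pd2 f i z +
    θ * ∑ i, ∑ j ∈ univ.erase i, (1 / (z i - z j)) * pd f i z

/-- The interlacing domain `W^{(k)}(x) = {y : x_1 ≤ y_1 ≤ x_2 ≤ y_2 ≤ … ≤ y_k ≤ x_{k+1}}`. -/
def DAdomain (k : ℕ) (x : Fin (k + 1) → ℝ) : Set (Fin k → ℝ) :=
  {y | ∀ i : Fin k, x i.castSucc ≤ y i ∧ y i ≤ x i.succ}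

/-- The Dixon–Anderson conditional probability density `Λ^{(k)}(x,y)` with parameter `β`. -/
noncomputable def DAdensity (k : ℕ) (β : ℝ) (x : Fin (k + 1) → ℝ) (y : Fin k → ℝ) : ℝ :=
  (Real.Gamma (β * (k + 1) / 2) / Real.Gamma (β / 2) ^ (k + 1)) *
    (∏ i : Fin (k + 1), ∏ j ∈ Ioi i, (x j - x i) ^ (1 - β)) *
    (∏ i : Fin k, ∏ j ∈ Ioi i, (y j - y i)) *
    (∏ i : Fin k, ∏ j : Fin (k + 1), |y i - x j| ^ (β / 2 - 1))


open MvPolynomial in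
theorem DA_esymm_hom (k r : ℕ) : (esymm (Fin k) ℝ r).IsHomogeneous r := by
  apply IsHomogeneous.sum
  intro t ht
  have := IsHomogeneous.prod t (fun l => (X l : MvPolynomial (Fin k) ℝ))
    (fun _ => 1) (fun l _ => isHomogeneous_X _ l)
  simpa [(mem_powersetCard.1 ht).2] using this

open MvPolynomial in
theorem DA_exists_F (k : ℕ) (P : MvPolynomial (Fin k) ℝ) (hP : P.IsSymmetric) :
    ∃ F : MvPolynomial (Fin k) ℝ,
      aeval (fun i : Fin k => esymm (Fin k) ℝ (i + 1)) F = P ∧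
      ∀ m ∈ F.support, Finsupp.weight (fun i : Fin k => (i : ℕ) + 1) m ≤ P.totalDegree := by
  classical
  obtain ⟨F, hF⟩ := (esymmAlgHom_fin_bijective (R := ℝ) k).2 ⟨P, hP⟩
  have hF' : aeval (fun i : Fin k => esymm (Fin k) ℝ (i + 1)) F = P := by
    rw [← esymmAlgHom_apply, hF]
  set e : Fin k → MvPolynomial (Fin k) ℝ := fun i => esymm (Fin k) ℝ (i + 1) with he
  set wt : Fin k → ℕ := fun i => (i : ℕ) + 1 with hwt
  have hhom : ∀ m : Fin k →₀ ℕ, ∀ c : ℝ, (aeval e (monomial m c)).IsHomogeneous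
      (Finsupp.weight wt m) := by
    intro m c
    rw [aeval_monomial, Finsupp.weight_apply, Finsupp.prod, Finsupp.sum]
    have : (∏ a ∈ m.support, e a ^ m a).IsHomogeneous (∑ a ∈ m.support, m a • wt a) := by
      apply IsHomogeneous.prod
      intro i _
      have h := (DA_esymm_hom k (i+1)).pow (m i)
      simpa [mul_comm] using h
    simpa using (isHomogeneous_C (Fin k) c).mul this
  refine ⟨∑ m ∈ F.support with Finsupp.weight wt m ≤ P.totalDegree, monomial m (coeff m F), ?_, ?_⟩
  · have key : ∀ n, homogeneousComponent n P =
        ∑ m ∈ F.support with Finsupp.weight wt m = n, aeval e (monomial m (coeff m F)) := by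
      intro n
      conv_lhs => rw [← hF', F.as_sum, map_sum, map_sum]
      rw [Finset.sum_filter]
      apply Finset.sum_congr rfl
      intro m _
      rw [homogeneousComponent_of_mem (hhom m _)]
      simp [eq_comm]
    conv_rhs => rw [← sum_homogeneousComponent P]
    rw [map_sum]
    simp_rw [key]
    rw [← Finset.sum_fiberwise_of_maps_to (g := fun m => Finsupp.weight wt m)
      (t := range (P.totalDegree + 1))]
    · apply Finset.sum_congr rfl
      intro n hn
      apply Finset.sum_congr _ (fun _ _ => rfl)
      ext m
      simp at hn ⊢
      omega
    · intro m hm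
      simp at hm ⊢
      omega
  · intro m hm
    have := MvPolynomial.support_sum hm
    simp only [Finset.mem_biUnion, Finset.mem_filter] at this
    obtain ⟨m', hm', h2⟩ := this
    have := support_monomial_subset h2
    simp at this
    rw [this]; exact hm'.2

/-- elementary symmetric polynomial of the interlacing points, generic version -/
noncomputable def DAE (n : ℕ) (r : ℕ) :
    MvPolynomial (Fin n) (MvPolynomial (Fin n) ℝ) :=
  ∑ i, MvPolynomial.C (MvPolynomial.X i) *
    ∑ t ∈ powersetCard r (univ.erase i), ∏ l ∈ t, MvPolynomial.X l

noncomputable def DAe (n : ℕ) (r : ℕ) (w x : Fin n → ℝ) : ℝ :=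
  ∑ i, w i * ∑ t ∈ powersetCard r (univ.erase i), ∏ l ∈ t, x l

open MvPolynomial in
theorem DAE_deg (n r : ℕ) : (DAE n r).totalDegree ≤ r := by
  apply IsHomogeneous.totalDegree_le
  apply IsHomogeneous.sum
  intro i _
  apply IsHomogeneous.C_mul
  apply IsHomogeneous.sum
  intro t ht
  have := IsHomogeneous.prod t (fun l => (X l : MvPolynomial (Fin n) (MvPolynomial (Fin n) ℝ)))
    (fun _ => 1) (fun l _ => isHomogeneous_X _ l)
  simpa [(mem_powersetCard.1 ht).2] using this

theorem DAe_perm (n r : ℕ) (w x : Fin n → ℝ) (σ : Equiv.Perm (Fin n)) :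
    DAe n r (w ∘ σ) (x ∘ σ) = DAe n r w x := by
  unfold DAe
  rw [← Equiv.sum_comp σ (fun i => w i * ∑ t ∈ powersetCard r (univ.erase i), ∏ l ∈ t, x l)]
  apply Finset.sum_congr rfl
  intro i _
  have : univ.erase (σ i) = (univ.erase i).map σ.toEmbedding := by
    ext j; simp
  rw [this, Finset.powersetCard_map, Finset.sum_map]
  simp

noncomputable def DAG (n k : ℕ) (F : MvPolynomial (Fin k) ℝ) :
    MvPolynomial (Fin n) (MvPolynomial (Fin n) ℝ) :=
  MvPolynomial.aeval (fun i : Fin k => DAE n (i + 1)) F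

open MvPolynomial in
theorem DAG_deg (n k d : ℕ) (F : MvPolynomial (Fin k) ℝ)
    (hF : ∀ m ∈ F.support, Finsupp.weight (fun i : Fin k => (i : ℕ) + 1) m ≤ d) :
    (DAG n k F).totalDegree ≤ d := by
  unfold DAG
  rw [F.as_sum, map_sum]
  apply totalDegree_finsetSum_le
  intro m hm
  refine le_trans ?_ (hF m hm)
  rw [aeval_monomial, Finsupp.weight_apply, Finsupp.prod, Finsupp.sum]
  refine (totalDegree_mul _ _).trans ?_
  have h0 : (algebraMap ℝ (MvPolynomial (Fin n) (MvPolynomial (Fin n) ℝ)) (coeff m F)).totalDegree = 0 := by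
    rw [IsScalarTower.algebraMap_apply ℝ (MvPolynomial (Fin n) ℝ)]
    exact totalDegree_C _
  rw [h0, zero_add]
  refine (totalDegree_finsetProd _ _).trans ?_
  apply Finset.sum_le_sum
  intro i _
  refine (totalDegree_pow _ _).trans ?_
  exact Nat.mul_le_mul_left _ (DAE_deg _ _)

open MvPolynomial in
theorem DAG_eval (n k : ℕ) (F : MvPolynomial (Fin k) ℝ) (w x : Fin n → ℝ) :
    eval w (eval (fun i => C (x i)) (DAG n k F)) =
      eval (fun i : Fin k => DAe n (i+1) w x) F := by
  have : ((eval w).comp (eval (fun i => C (x i)))).comp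
      ((aeval (fun i : Fin k => DAE n (i + 1)) : MvPolynomial (Fin k) ℝ →ₐ[ℝ] _).toRingHom) =
      eval (fun i : Fin k => DAe n (i+1) w x) := by
    apply MvPolynomial.ringHom_ext
    · intro r
      simp [IsScalarTower.algebraMap_apply ℝ (MvPolynomial (Fin n) ℝ)
        (MvPolynomial (Fin n) (MvPolynomial (Fin n) ℝ)), MvPolynomial.algebraMap_eq]
    · intro i
      simp [DAE, DAe]
  exact congrArg (fun f => f F) this

open MvPolynomial in
theorem DA_mapRange (n : ℕ) (L : MvPolynomial (Fin n) ℝ →ₗ[ℝ] ℝ)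
    (G : MvPolynomial (Fin n) (MvPolynomial (Fin n) ℝ)) :
    ∃ Q : MvPolynomial (Fin n) ℝ, Q.totalDegree ≤ G.totalDegree ∧
      ∀ x : Fin n → ℝ, eval x Q = L (eval (fun i => C (x i)) G) := by
  classical
  refine ⟨∑ m ∈ G.support, monomial m (L (coeff m G)), ?_, ?_⟩
  · apply totalDegree_finsetSum_le
    intro m hm
    refine (totalDegree_monomial_le _ _).trans ?_
    exact le_totalDegree hm
  · intro x
    conv_rhs => rw [G.as_sum]
    simp only [map_sum, eval_monomial]
    apply Finset.sum_congr rfl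
    intro m _
    have : coeff m G * (m.prod fun n e => C (x n) ^ e)
      = (m.prod fun n e => x n ^ e) • coeff m G := by
      rw [smul_eq_C_mul, mul_comm]
      congr 1
      simp [Finsupp.prod]
    rw [this, map_smul, smul_eq_mul, mul_comm]

def DAW {k : ℕ} (w : Fin k → ℝ) : Fin (k + 1) → ℝ := Fin.cons (1 - ∑ i, w i) w

def DAS (k : ℕ) : Set (Fin k → ℝ) := {w | ∀ i, 0 < DAW w i}

theorem DAW_sum {k : ℕ} (w : Fin k → ℝ) : ∑ i, DAW w i = 1 := by
  simp [DAW, Fin.sum_univ_succ]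

@[fun_prop]
theorem DAW_cont {k : ℕ} : Continuous (DAW (k := k)) := by
  unfold DAW
  refine continuous_pi fun i => ?_
  refine Fin.cases ?_ (fun j => ?_) i
  · simp; fun_prop
  · simp; fun_prop

theorem DAS_meas (k : ℕ) : MeasurableSet (DAS k) := by
  have : IsOpen (DAS k) := by
    have : DAS k = ⋂ i, {w | 0 < DAW w i} := by ext; simp [DAS]
    rw [this]
    refine isOpen_iInter_of_finite fun i => ?_
    have h : Continuous fun w : Fin k → ℝ => DAW w i := (continuous_apply i).comp DAW_cont
    exact isOpen_lt continuous_const h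
  exact this.measurableSet

def DAL {k : ℕ} (σ : Equiv.Perm (Fin (k + 1))) : (Fin k → ℝ) →ₗ[ℝ] (Fin k → ℝ) where
  toFun w := fun i => (Fin.cons (- ∑ i, w i) w : Fin (k + 1) → ℝ) (σ i.succ)
  map_add' u v := by
    ext i
    dsimp only [Pi.add_apply]
    refine Fin.cases ?_ (fun j => ?_) (σ i.succ)
    · simp [Finset.sum_add_distrib]; ring
    · simp
  map_smul' c v := by
    ext i
    dsimp
    refine Fin.cases ?_ (fun j => ?_) (σ i.succ)
    · simp [Finset.mul_sum]
    · simp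

theorem DAL_cons {k : ℕ} (σ : Equiv.Perm (Fin (k + 1))) (w : Fin k → ℝ) :
    (Fin.cons (- ∑ i, DAL σ w i) (DAL σ w) : Fin (k + 1) → ℝ) =
      (Fin.cons (- ∑ i, w i) w : Fin (k + 1) → ℝ) ∘ σ := by
  ext i
  refine Fin.cases ?_ (fun j => ?_) i
  · have h : ∑ i, ((Fin.cons (- ∑ i, w i) w : Fin (k + 1) → ℝ) ∘ σ) i = 0 := by
      have := Equiv.sum_comp σ (Fin.cons (- ∑ i, w i) w : Fin (k + 1) → ℝ)
      simp only [Function.comp]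
      rw [this, Fin.sum_univ_succ]
      simp
    rw [Fin.sum_univ_succ] at h
    have h2 : ∑ i, DAL σ w i =
      ∑ i : Fin k, ((Fin.cons (- ∑ i, w i) w : Fin (k + 1) → ℝ) ∘ σ) i.succ := rfl
    rw [Fin.cons_zero, h2]
    linarith
  · simp [DAL]

theorem DAL_mul {k : ℕ} (σ τ : Equiv.Perm (Fin (k + 1))) :
    DAL (σ * τ) = DAL τ * DAL σ := by
  apply LinearMap.ext
  intro w
  funext i
  have := congrFun (DAL_cons σ w) (τ i.succ)
  exact this.symm

theorem DAL_one {k : ℕ} : DAL (1 : Equiv.Perm (Fin (k + 1))) = 1 := by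
  apply LinearMap.ext
  intro w
  funext i
  simp [DAL]

theorem DAL_det {k : ℕ} (σ : Equiv.Perm (Fin (k + 1))) : |LinearMap.det (DAL σ)| = 1 := by
  let d : Equiv.Perm (Fin (k + 1)) →* ℝ :=
    { toFun := fun σ => LinearMap.det (DAL σ)
      map_one' := by rw [DAL_one]; simp
      map_mul' := fun σ τ => by rw [DAL_mul, map_mul, mul_comm] }
  have h : d σ ^ orderOf σ = 1 := by rw [← map_pow, pow_orderOf_eq_one, map_one]
  have h2 : |d σ| ^ orderOf σ = 1 := by rw [← abs_pow, h, abs_one]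
  exact (pow_eq_one_iff_of_nonneg (abs_nonneg _) (orderOf_pos σ).ne').1 h2

def DAT {k : ℕ} (σ : Equiv.Perm (Fin (k + 1))) (w : Fin k → ℝ) : Fin k → ℝ :=
  fun i => DAW w (σ i.succ)

theorem DAW_DAT {k : ℕ} (σ : Equiv.Perm (Fin (k + 1))) (w : Fin k → ℝ) :
    DAW (DAT σ w) = DAW w ∘ σ := by
  ext i
  refine Fin.cases ?_ (fun j => ?_) i
  · have h : ∑ i, (DAW w ∘ σ) i = 1 := by
      have := Equiv.sum_comp σ (DAW w)
      simp only [Function.comp]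
      rw [this, DAW_sum]
    rw [Fin.sum_univ_succ] at h
    have h2 : ∑ i, DAT σ w i = ∑ i : Fin k, (DAW w ∘ σ) i.succ := rfl
    rw [DAW, Fin.cons_zero, h2]
    linarith
  · simp [DAW, DAT]

theorem DAW_tail {k : ℕ} (w : Fin k → ℝ) (i : Fin k) : DAW w i.succ = w i := by simp [DAW]

theorem DAT_DAT {k : ℕ} (σ τ : Equiv.Perm (Fin (k + 1))) (w : Fin k → ℝ) :
    DAT τ (DAT σ w) = DAT (σ * τ) w := by
  funext i
  simp [DAT, DAW_DAT]

theorem DAT_one {k : ℕ} (w : Fin k → ℝ) : DAT 1 w = w := by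
  funext i
  simp [DAT, DAW_tail]

theorem DAT_cont {k : ℕ} (σ : Equiv.Perm (Fin (k + 1))) : Continuous (DAT σ) :=
  continuous_pi fun i => (continuous_apply (σ i.succ)).comp DAW_cont

def DATh {k : ℕ} (σ : Equiv.Perm (Fin (k + 1))) : (Fin k → ℝ) ≃ₜ (Fin k → ℝ) where
  toFun := DAT σ
  invFun := DAT σ⁻¹
  left_inv w := by rw [DAT_DAT]; simp [DAT_one]
  right_inv w := by rw [DAT_DAT]; simp [DAT_one]
  continuous_toFun := DAT_cont σ
  continuous_invFun := DAT_cont σ⁻¹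

theorem DAT_mp {k : ℕ} (σ : Equiv.Perm (Fin (k + 1))) :
    MeasurePreserving (DAT (k := k) σ) volume volume := by
  have h1 : MeasurePreserving (DAL (k := k) σ) volume volume := by
    refine ⟨(DAL σ).continuous_of_finiteDimensional.measurable, ?_⟩
    rw [Real.map_linearMap_volume_pi_eq_smul_volume_pi, abs_inv, DAL_det]
    · simp
    · intro h
      have := DAL_det σ
      rw [h] at this; simp at this
  have h2 := (measurePreserving_add_right (volume : Measure (Fin k → ℝ)) (DAT σ 0)).comp h1
  convert h2 using 1
  funext w
  funext i
  simp only [DAT, DAW, DAL, Function.comp, LinearMap.coe_mk, AddHom.coe_mk, Pi.add_apply]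
  refine Fin.cases ?_ (fun j => ?_) (σ i.succ)
  · simp; ring
  · simp

theorem DAT_pre {k : ℕ} (σ : Equiv.Perm (Fin (k + 1))) : DAT σ ⁻¹' (DAS k) = DAS k := by
  ext w
  simp only [DAS, Set.mem_preimage, Set.mem_ofPred_eq, DAW_DAT, Function.comp]
  exact ⟨fun h i => by simpa using h (σ.symm i), fun h i => h _⟩

theorem DA_int_perm {k : ℕ} (σ : Equiv.Perm (Fin (k + 1))) (f : (Fin (k+1) → ℝ) → ℝ) :
    ∫ w in DAS k, f (DAW w ∘ σ) = ∫ w in DAS k, f (DAW w) := by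
  have := (DAT_mp σ).setIntegral_preimage_emb (DATh σ).measurableEmbedding
    (fun w => f (DAW w)) (DAS k)
  rw [DAT_pre] at this
  simpa [DAW_DAT] using this

theorem DA_intg_perm {k : ℕ} (σ : Equiv.Perm (Fin (k + 1))) (f : (Fin (k+1) → ℝ) → ℝ)
    (h : IntegrableOn (fun w => f (DAW w)) (DAS k)) :
    IntegrableOn (fun w => f (DAW w ∘ σ)) (DAS k) := by
  have := ((DAT_mp σ).integrableOn_comp_preimage (DATh σ).measurableEmbedding
    (f := fun w => f (DAW w)) (s := DAS k)).2 h
  rw [DAT_pre] at this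
  simpa [DAW_DAT, Function.comp_def] using this

theorem DAW_le {k : ℕ} {w : Fin k → ℝ} (hw : w ∈ DAS k) (i) : DAW w i ≤ 1 := by
  rw [← DAW_sum w]
  exact Finset.single_le_sum (fun j _ => (hw j).le) (mem_univ i)

theorem DA_intg0 {k : ℕ} (a : ℝ) (ha : -1 < a) :
    IntegrableOn (fun w : Fin k → ℝ => ∏ j : Fin k, (DAW w j.succ) ^ a) (DAS k) := by
  have h1 : IntegrableOn (fun t : ℝ => t ^ a) (Set.Ioc 0 1) := by
    rw [integrableOn_Ioc_iff_integrableOn_Ioo]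
    exact (intervalIntegral.integrableOn_Ioo_rpow_iff one_pos).2 ha
  have h2 : Integrable (fun w : Fin k → ℝ => ∏ j : Fin k, (Set.Ioc (0:ℝ) 1).indicator
      (fun t : ℝ => t ^ a) (w j)) :=
    Integrable.fintype_prod (fun _ => (integrable_indicator_iff measurableSet_Ioc).2 h1)
  refine (h2.integrableOn (s := DAS k)).congr_fun ?_ (DAS_meas k)
  intro w hw
  refine Finset.prod_congr rfl fun j _ => ?_
  have hj : w j ∈ Set.Ioc (0:ℝ) 1 := by
    rw [← DAW_tail w j]
    exact ⟨hw _, DAW_le hw _⟩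
  rw [Set.indicator_of_mem hj, DAW_tail]

theorem DA_intg {k : ℕ} (a : ℝ) (ha : -1 < a) :
    IntegrableOn (fun w : Fin k → ℝ => ∏ j, (DAW w j) ^ a) (DAS k) := by
  set C : ℝ := 1 + (1 / ((k:ℝ) + 1)) ^ a with hC
  have hN : 0 < 1 / ((k:ℝ) + 1) := by positivity
  have hC0 : 0 ≤ C := by positivity
  have hb : IntegrableOn (fun w : Fin k → ℝ => ∑ i : Fin (k+1), C *
      (fun W : Fin (k+1) → ℝ => ∏ j : Fin k, (W j.succ) ^ a) (DAW w ∘ Equiv.swap 0 i)) (DAS k) := by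
    refine integrable_finsetSum _ fun i _ => ?_
    exact (DA_intg_perm (Equiv.swap 0 i) (fun W => ∏ j : Fin k, (W j.succ) ^ a)
      (DA_intg0 a ha)).const_mul C
  refine Integrable.mono' hb ?_ ?_
  · apply Measurable.aestronglyMeasurable
    refine Finset.measurable_prod _ fun j _ => ?_
    have h : Measurable fun w : Fin k → ℝ => DAW w j :=
      ((continuous_apply j).comp DAW_cont).measurable
    exact h.pow_const a
  · refine (ae_restrict_iff' (DAS_meas k)).2 (Filter.Eventually.of_forall fun w hw => ?_)
    have hpos : ∀ j, 0 < DAW w j ^ a := fun j => Real.rpow_pos_of_pos (hw j) a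
    rw [Real.norm_of_nonneg (Finset.prod_nonneg fun j _ => (hpos j).le)]
    obtain ⟨i, hi⟩ : ∃ i, 1 / ((k:ℝ) + 1) ≤ DAW w i := by
      by_contra! hcon
      have h1 := Finset.sum_lt_sum_of_nonempty (s := (univ : Finset (Fin (k+1))))
        univ_nonempty (fun i _ => hcon i)
      rw [DAW_sum] at h1
      simp at h1
      rw [mul_inv_cancel₀ (by positivity)] at h1
      exact lt_irrefl _ h1
    have hle : DAW w i ^ a ≤ C := by
      rcases le_or_gt 0 a with h0 | h0
      · have := Real.rpow_le_one (hw i).le (DAW_le hw i) h0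
        have h3 : 0 ≤ (1 / ((k:ℝ) + 1)) ^ a := by positivity
        linarith
      · have := Real.rpow_le_rpow_of_nonpos hN hi h0.le
        linarith
    have hg : ∀ i, 0 ≤ (fun W : Fin (k+1) → ℝ => ∏ j : Fin k, (W j.succ) ^ a)
        (DAW w ∘ Equiv.swap 0 i) := fun i => Finset.prod_nonneg fun j _ => (hpos _).le
    refine le_trans ?_ (Finset.single_le_sum (fun j _ => mul_nonneg hC0 (hg j)) (mem_univ i))
    rw [← Equiv.prod_comp (Equiv.swap 0 i) (fun j => DAW w j ^ a), Fin.prod_univ_succ]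
    rw [Equiv.swap_apply_left]
    exact mul_le_mul_of_nonneg_right hle (hg i)

noncomputable def DALin (k : ℕ) (a : ℝ) (ha : -1 < a) (c : ℝ) :
    MvPolynomial (Fin (k+1)) ℝ →ₗ[ℝ] ℝ := by
  have hI : ∀ g : MvPolynomial (Fin (k+1)) ℝ, IntegrableOn
      (fun w : Fin k → ℝ => (∏ j, (DAW w j) ^ a) * MvPolynomial.eval (DAW w) g) (DAS k) := by
    intro g
    have hc : Continuous fun W : Fin (k+1) → ℝ => MvPolynomial.eval W g :=
      MvPolynomial.continuous_eval g
    obtain ⟨B, hB⟩ := (isCompact_Icc (a := (0 : Fin (k+1) → ℝ)) (b := 1)).exists_bound_of_continuousOn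
      hc.continuousOn
    refine Integrable.mul_bdd (c := B) (DA_intg a ha) ?_ ?_
    · exact (hc.comp DAW_cont).measurable.aestronglyMeasurable
    · refine (ae_restrict_iff' (DAS_meas k)).2 (Filter.Eventually.of_forall fun w hw => ?_)
      exact hB _ ⟨fun i => (hw i).le, fun i => DAW_le hw i⟩
  exact
  { toFun := fun g => c * ∫ w in DAS k, (∏ j, (DAW w j) ^ a) * MvPolynomial.eval (DAW w) g
    map_add' := by
      intro g h
      rw [← mul_add, ← integral_add (hI g) (hI h)]
      simp [mul_add]
    map_smul' := by
      intro r g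
      simp only [MvPolynomial.smul_eval, RingHom.id_apply, smul_eq_mul]
      rw [mul_left_comm r c, ← integral_const_mul r]
      congr 2
      funext w
      ring }

theorem DALin_apply (k : ℕ) (a : ℝ) (ha : -1 < a) (c : ℝ) (g : MvPolynomial (Fin (k+1)) ℝ) :
    DALin k a ha c g =
      c * ∫ w in DAS k, (∏ j, (DAW w j) ^ a) * MvPolynomial.eval (DAW w) g := rfl

def DAU {k : ℕ} (x : Fin (k + 1) → ℝ) : Set (Fin k → ℝ) :=
  {y | ∀ i : Fin k, x i.castSucc < y i ∧ y i < x i.succ}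

noncomputable def DAwt {k : ℕ} (x : Fin (k + 1) → ℝ) (y : Fin k → ℝ) (i : Fin (k + 1)) : ℝ :=
  ∏ j : Fin k, ((y j - x i) / (x (i.succAbove j) - x i))

theorem DA_sA_ne {k : ℕ} {x : Fin (k + 1) → ℝ} (hx : StrictMono x) (i : Fin (k+1)) (j : Fin k) :
    x (i.succAbove j) - x i ≠ 0 :=
  sub_ne_zero.2 fun h => Fin.succAbove_ne i j (hx.injective h)

theorem DAwt_pos {k : ℕ} {x : Fin (k + 1) → ℝ} (hx : StrictMono x) {y : Fin k → ℝ}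
    (hy : y ∈ DAU x) (i : Fin (k + 1)) : 0 < DAwt x y i := by
  refine Finset.prod_pos fun j _ => ?_
  rcases lt_or_ge j.castSucc i with h | h
  · rw [Fin.succAbove_of_castSucc_lt _ _ h]
    have h1 := (hy j).2
    have h2 := hx h
    have h3 : x j.succ ≤ x i := hx.monotone (Fin.castSucc_lt_iff_succ_le.1 h)
    exact div_pos_of_neg_of_neg (by linarith) (by linarith)
  · rw [Fin.succAbove_of_le_castSucc _ _ h]
    have h1 := (hy j).1
    have h2 : x i ≤ x j.castSucc := hx.monotone h
    have h3 : x j.castSucc < x j.succ := hx (Fin.castSucc_lt_succ)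
    exact div_pos (by linarith) (by linarith)

open Polynomial in
/-- The polynomial with roots `y`. -/
noncomputable def DApoly {k : ℕ} (y : Fin k → ℝ) : ℝ[X] := ∏ j, (X - C (y j))

open Polynomial in
theorem DApoly_monic {k : ℕ} (y : Fin k → ℝ) : (DApoly y).Monic :=
  monic_prod_of_monic _ _ fun _ _ => monic_X_sub_C _

open Polynomial in
theorem DApoly_degree {k : ℕ} (y : Fin k → ℝ) : (DApoly y).degree = k := by
  simp [DApoly, degree_prod]

open Polynomial in
theorem DApoly_coeff {k : ℕ} (y : Fin k → ℝ) (r : ℕ) (hr : r ≤ k) :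
    (DApoly y).coeff (k - r) = (-1) ^ r * ∑ t ∈ powersetCard r univ, ∏ l ∈ t, y l := by
  have h := Multiset.prod_X_sub_C_coeff ((univ : Finset (Fin k)).val.map y) (k := k - r) (by simp)
  rw [Multiset.map_map] at h
  have h2 : k - (k - r) = r := by omega
  simp only [Multiset.card_map, Finset.card_val, Finset.card_univ, Fintype.card_fin, h2,
    Finset.esymm_map_val] at h
  exact h

open Polynomial in
noncomputable def DAR {k : ℕ} (x W : Fin (k + 1) → ℝ) : ℝ[X] :=
  ∑ i, C (W i) * DApoly (fun j => x (i.succAbove j))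

open Polynomial in
theorem DAR_degree {k : ℕ} (x W : Fin (k + 1) → ℝ) : (DAR x W).degree ≤ k := by
  unfold DAR
  refine (degree_sum_le _ _).trans (Finset.sup_le fun i _ => ?_)
  refine (degree_mul_le _ _).trans ?_
  rw [DApoly_degree]
  calc (C (W i)).degree + (k : WithBot ℕ) ≤ 0 + (k : WithBot ℕ) := by gcongr; exact degree_C_le
    _ = k := zero_add _

open Polynomial in
theorem DAR_coeff {k : ℕ} (x W : Fin (k + 1) → ℝ) (r : ℕ) (hr : r ≤ k) :
    (DAR x W).coeff (k - r) = (-1) ^ r * DAe (k+1) r W x := by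
  unfold DAR DAe
  rw [finsetSum_coeff, Finset.mul_sum]
  refine Finset.sum_congr rfl fun i _ => ?_
  rw [coeff_C_mul, DApoly_coeff _ _ hr]
  have : univ.erase i = univ.map (Fin.succAboveEmb i) := by
    ext j
    simp only [mem_erase, mem_univ, and_true, mem_map, true_and]
    constructor
    · intro h; obtain ⟨l, hl⟩ := Fin.exists_succAbove_eq h; exact ⟨l, hl⟩
    · rintro ⟨l, rfl⟩; exact Fin.succAbove_ne i l
  rw [this, Finset.powersetCard_map, Finset.sum_map]
  simp
  ring

open Polynomial in
theorem DAR_eval {k : ℕ} (x W : Fin (k + 1) → ℝ) (i : Fin (k+1)) :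
    (DAR x W).eval (x i) = W i * ∏ j, (x i - x (i.succAbove j)) := by
  unfold DAR DApoly
  simp only [eval_finsetSum, eval_mul, eval_C, eval_prod, eval_sub, eval_X]
  rw [Finset.sum_eq_single i]
  · intro b _ hb
    obtain ⟨l, hl⟩ := Fin.exists_succAbove_eq hb.symm
    rw [Finset.prod_eq_zero (mem_univ l) (by rw [hl, sub_self]), mul_zero]
  · simp

open Polynomial in
theorem DApoly_eval {k : ℕ} {x : Fin (k + 1) → ℝ} (hx : StrictMono x) (y : Fin k → ℝ) (i) :
    (DApoly y).eval (x i) = DAwt x y i * ∏ j, (x i - x (i.succAbove j)) := by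
  unfold DApoly DAwt
  simp only [eval_prod, eval_sub, eval_X, eval_C]
  rw [← Finset.prod_mul_distrib]
  refine Finset.prod_congr rfl fun j _ => ?_
  have := DA_sA_ne hx i j
  field_simp
  ring

theorem DA_poly_eq {k : ℕ} {x : Fin (k + 1) → ℝ} (hx : StrictMono x) (y : Fin k → ℝ) :
    DApoly y = DAR x (DAwt x y) := by
  have hk : ((k:ℕ) : WithBot ℕ) < ((#(univ : Finset (Fin (k+1))) : ℕ) : WithBot ℕ) := by
    simp
    exact_mod_cast Nat.lt_succ_self k
  refine Polynomial.eq_of_degrees_lt_of_eval_index_eq (v := x) univ hx.injective.injOn ?_ ?_ ?_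
  · rw [DApoly_degree]; exact hk
  · exact (DAR_degree _ _).trans_lt hk
  · intro i _
    rw [DApoly_eval hx, DAR_eval]

theorem DA_esymm_y {k : ℕ} {x : Fin (k + 1) → ℝ} (hx : StrictMono x) (y : Fin k → ℝ)
    (r : ℕ) (hr : r ≤ k) :
    ∑ t ∈ powersetCard r univ, ∏ l ∈ t, y l = DAe (k+1) r (DAwt x y) x := by
  have := DAR_coeff x (DAwt x y) r hr
  rw [← DA_poly_eq hx, DApoly_coeff _ _ hr] at this
  exact mul_left_cancel₀ (by positivity) this

theorem DAe_zero {k : ℕ} (W x : Fin (k + 1) → ℝ) : DAe (k+1) 0 W x = ∑ i, W i := by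
  simp [DAe]

theorem DAwt_sum {k : ℕ} {x : Fin (k + 1) → ℝ} (hx : StrictMono x) (y : Fin k → ℝ) :
    ∑ i, DAwt x y i = 1 := by
  rw [← DAe_zero _ x, ← DA_esymm_y hx y 0 (by omega)]
  simp

noncomputable def DAphi {k : ℕ} (x : Fin (k + 1) → ℝ) (y : Fin k → ℝ) : Fin k → ℝ :=
  fun i => DAwt x y i.succ

theorem DAW_phi {k : ℕ} {x : Fin (k + 1) → ℝ} (hx : StrictMono x) (y : Fin k → ℝ) :
    DAW (DAphi x y) = DAwt x y := by
  ext i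
  refine Fin.cases ?_ (fun j => ?_) i
  · have := DAwt_sum hx y
    rw [Fin.sum_univ_succ] at this
    have h2 : ∑ i, DAphi x y i = ∑ i : Fin k, DAwt x y i.succ := rfl
    rw [DAW, Fin.cons_zero, h2]
    linarith
  · simp [DAW, DAphi]

theorem DAU_mono {k : ℕ} {x : Fin (k + 1) → ℝ} (hx : StrictMono x) {y y' : Fin k → ℝ}
    (hy : y ∈ DAU x) (hy' : y' ∈ DAU x) {i j : Fin k} (hij : i < j) : y i < y' j := by
  have h1 := (hy i).2
  have h2 := (hy' j).1
  have h3 : x i.succ ≤ x j.castSucc := hx.monotone (by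
    rw [Fin.le_def]; simp; exact hij)
  linarith

theorem DAphi_inj {k : ℕ} {x : Fin (k + 1) → ℝ} (hx : StrictMono x) :
    Set.InjOn (DAphi x) (DAU x) := by
  intro y hy y' hy' h
  have hw : DAwt x y = DAwt x y' := by rw [← DAW_phi hx, ← DAW_phi hx, h]
  have hp : DApoly y = DApoly y' := by rw [DA_poly_eq hx, DA_poly_eq hx, hw]
  funext i
  have h0 : (DApoly y').eval (y i) = 0 := by
    rw [← hp]
    simp only [DApoly, Polynomial.eval_prod]
    exact Finset.prod_eq_zero (mem_univ i) (by simp)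
  simp only [DApoly, Polynomial.eval_prod, Finset.prod_eq_zero_iff] at h0
  obtain ⟨j, _, hj⟩ := h0
  simp [sub_eq_zero] at hj
  rcases lt_trichotomy i j with h | h | h
  · exact absurd hj (DAU_mono hx hy hy' h).ne
  · rw [hj, h]
  · exact absurd hj (DAU_mono hx hy' hy h).ne'

theorem DA_sign {k : ℕ} {x : Fin (k + 1) → ℝ} (hx : StrictMono x) (m : Fin k) :
    (∏ j, (x m.castSucc - x (m.castSucc.succAbove j))) *
      (∏ j, (x m.succ - x (m.succ.succAbove j))) < 0 := by
  rw [← Finset.prod_mul_distrib, ← Finset.mul_prod_erase univ _ (mem_univ m)]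
  have h0 : x m.castSucc < x m.succ := hx Fin.castSucc_lt_succ
  apply mul_neg_of_neg_of_pos
  · rw [Fin.succAbove_castSucc_self, Fin.succAbove_succ_self]
    nlinarith
  · refine Finset.prod_pos fun j hj => ?_
    have hj : j ≠ m := (mem_erase.1 hj).1
    rcases lt_or_gt_of_ne hj with h | h
    · rw [Fin.succAbove_of_castSucc_lt _ _ (by simpa using h),
        Fin.succAbove_of_castSucc_lt _ _ (by rw [Fin.lt_def] at *; simp; omega)]
      have h1 : x j.castSucc < x m.castSucc := hx (by simpa using h)
      exact mul_pos (by linarith) (by linarith)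
    · rw [Fin.succAbove_of_le_castSucc _ _ (by rw [Fin.lt_def] at h; rw [Fin.le_def]; simp; omega),
        Fin.succAbove_of_le_castSucc _ _ (by rw [Fin.lt_def] at h; rw [Fin.le_def]; simp; omega)]
      have h1 : x m.succ < x j.succ := hx (by simpa using h)
      exact mul_pos_of_neg_of_neg (by linarith) (by linarith)

theorem DAphi_image {k : ℕ} {x : Fin (k + 1) → ℝ} (hx : StrictMono x) :
    DAphi x '' DAU x = DAS k := by
  apply Set.Subset.antisymm
  · rintro _ ⟨y, hy, rfl⟩ i
    rw [DAW_phi hx]; exact DAwt_pos hx hy i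
  · intro w hw
    have hroot : ∀ m : Fin k, ∃ z, (x m.castSucc < z ∧ z < x m.succ) ∧ (DAR x (DAW w)).eval z = 0 := by
      intro m
      have h0 : x m.castSucc < x m.succ := hx Fin.castSucc_lt_succ
      have hneg : (DAR x (DAW w)).eval (x m.castSucc) * (DAR x (DAW w)).eval (x m.succ) < 0 := by
        rw [DAR_eval, DAR_eval, mul_mul_mul_comm]
        exact mul_neg_of_pos_of_neg (mul_pos (hw _) (hw _)) (DA_sign hx m)
      have hc : ContinuousOn (fun z => (DAR x (DAW w)).eval z) (Set.Icc (x m.castSucc) (x m.succ)) :=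
        (DAR x (DAW w)).continuous.continuousOn
      rcases mul_neg_iff.1 hneg with ⟨h1, h2⟩ | ⟨h1, h2⟩
      · obtain ⟨z, hz, hz0⟩ := intermediate_value_Ioo' h0.le hc ⟨h2, h1⟩
        exact ⟨z, hz, hz0⟩
      · obtain ⟨z, hz, hz0⟩ := intermediate_value_Ioo h0.le hc ⟨h1, h2⟩
        exact ⟨z, hz, hz0⟩
    choose y hy hy0 using hroot
    have hyU : y ∈ DAU x := hy
    have hinj : Function.Injective y := by
      have : StrictMono y := fun i j hij => DAU_mono hx hyU hyU hij
      exact this.injective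
    have hcoef : (DAR x (DAW w)).coeff k = 1 := by
      have := DAR_coeff x (DAW w) 0 (by omega)
      simpa [DAe_zero, DAW_sum] using this
    have hdeg : (DAR x (DAW w)).degree = k := by
      apply le_antisymm (DAR_degree _ _)
      apply Polynomial.le_degree_of_ne_zero
      rw [hcoef]; exact one_ne_zero
    have hP : DAR x (DAW w) = DApoly y := by
      refine Polynomial.eq_of_degree_sub_lt_of_eval_index_eq (v := y) univ hinj.injOn ?_ ?_
      · have : (DAR x (DAW w) - DApoly y).degree < (DAR x (DAW w)).degree := by
          apply Polynomial.degree_sub_lt_left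
          · rw [hdeg, DApoly_degree]
          · intro h; rw [h] at hcoef; simp at hcoef
          · rw [(DApoly_monic y).leadingCoeff, Polynomial.leadingCoeff,
              Polynomial.natDegree_eq_of_degree_eq_some hdeg, hcoef]
        rw [hdeg] at this
        simpa using this
      · intro i _
        rw [hy0]
        simp only [DApoly, Polynomial.eval_prod]
        exact (Finset.prod_eq_zero (mem_univ i) (by simp)).symm
    refine ⟨y, hyU, ?_⟩
    funext i
    have h1 := DAR_eval x (DAW w) i.succ
    rw [hP, DApoly_eval hx] at h1
    have h2 : (∏ j, (x i.succ - x (i.succ.succAbove j))) ≠ 0 :=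
      Finset.prod_ne_zero_iff.2 fun j _ => by
        have := DA_sA_ne hx i.succ j
        intro h; apply this; linarith
    have := mul_right_cancel₀ h2 h1
    rw [DAW_tail] at this
    exact this

/-- Vandermonde product -/
noncomputable def DAV {n : ℕ} (v : Fin n → ℝ) : ℝ := ∏ i, ∏ j ∈ Ioi i, (v j - v i)

theorem DAV_pos {n : ℕ} {v : Fin n → ℝ} (hv : StrictMono v) : 0 < DAV v :=
  Finset.prod_pos fun _ _ => Finset.prod_pos fun _ hj => sub_pos.2 (hv (mem_Ioi.1 hj))

theorem DAV_sq {n : ℕ} (v : Fin n → ℝ) :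
    |∏ i, ∏ j ∈ univ.erase i, (v j - v i)| = |DAV v| * |DAV v| := by
  have h := Finset.prod_prod_Ioi_mul_eq_prod_prod_off_diag (fun a b : Fin n => v a - v b)
  have h2 : ∏ i, ∏ j ∈ univ.erase i, (v j - v i) = ∏ i, ∏ j ∈ {i}ᶜ, (v j - v i) := by
    simp [← Finset.compl_singleton]
  rw [h2, ← h]
  simp only [Finset.prod_mul_distrib, abs_mul]
  unfold DAV
  congr 1
  simp only [Finset.abs_prod]
  simp [abs_sub_comm]

theorem DA_erase {k : ℕ} (i : Fin (k+1)) (f : Fin (k+1) → ℝ) :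
    ∏ j ∈ univ.erase i, f j = ∏ j, f (i.succAbove j) := by
  have : univ.erase i = univ.map (Fin.succAboveEmb i) := by
    ext j
    simp only [mem_erase, mem_univ, and_true, mem_map, true_and]
    constructor
    · intro h; obtain ⟨l, hl⟩ := Fin.exists_succAbove_eq h; exact ⟨l, hl⟩
    · rintro ⟨l, rfl⟩; exact Fin.succAbove_ne i l
  rw [this, Finset.prod_map]
  simp

theorem DAV_succ {k : ℕ} (x : Fin (k+1) → ℝ) :
    DAV x = (∏ j : Fin k, (x j.succ - x 0)) * DAV (fun j => x j.succ) := by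
  unfold DAV
  rw [Fin.prod_univ_succ]
  simp [Fin.prod_Ioi_succ]

theorem DA_cprod {k : ℕ} {x : Fin (k+1) → ℝ} (hx : StrictMono x) :
    |∏ i : Fin k, ∏ j, (x (i.succ.succAbove j) - x i.succ)| = DAV x * DAV (fun j : Fin k => x j.succ) := by
  have h := DAV_sq x
  simp only [DA_erase] at h
  rw [Fin.prod_univ_succ, abs_mul, abs_of_pos (DAV_pos hx)] at h
  have hp : 0 < ∏ j : Fin k, (x (Fin.succAbove 0 j) - x 0) :=
    Finset.prod_pos fun j _ => sub_pos.2 (hx (by simp))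
  rw [abs_of_pos hp] at h
  apply mul_left_cancel₀ hp.ne'
  rw [h]
  nth_rewrite 2 [DAV_succ]
  simp
  ring

open Polynomial in
theorem DA_detN {k : ℕ} {y : Fin k → ℝ} (hy : StrictMono y) (u : Fin k → ℝ) :
    |(Matrix.of fun i j : Fin k => ∏ l ∈ univ.erase j, (y l - u i)).det| = |DAV u| * DAV y := by
  set p : Fin k → ℝ[X] := fun j => ∏ l ∈ univ.erase j, (C (y l) - X) with hp
  have hdeg : ∀ j, (p j).natDegree < k := by
    intro j
    refine lt_of_le_of_lt (natDegree_prod_le _ _) ?_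
    have : ∑ l ∈ univ.erase j, (C (y l) - X : ℝ[X]).natDegree ≤ ∑ l ∈ univ.erase j, 1 := by
      refine Finset.sum_le_sum fun l _ => ?_
      refine (natDegree_sub_le _ _).trans ?_
      simp
    refine lt_of_le_of_lt this ?_
    simp
    have := j.pos
    omega
  have hN : ∀ v : Fin k → ℝ, (Matrix.of fun i j : Fin k => ∏ l ∈ univ.erase j, (y l - v i)) =
      (Matrix.vandermonde v) * Matrix.of (fun (i j : Fin k) => (p j).coeff i) := by
    intro v
    ext i j
    rw [Matrix.mul_apply]
    simp only [Matrix.of_apply, Matrix.vandermonde_apply]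
    have := (p j).eval_eq_sum_range' (hdeg j) (v i)
    rw [← Fin.sum_univ_eq_sum_range (fun n => (p j).coeff n * v i ^ n)] at this
    simp only [mul_comm (v i ^ _)]
    rw [← this]
    simp [hp, eval_prod]
  have hV : ∀ v : Fin k → ℝ, (Matrix.vandermonde v).det = DAV v := fun v => Matrix.det_vandermonde v
  have hdiag : (Matrix.of fun i j : Fin k => ∏ l ∈ univ.erase j, (y l - y i)) =
      Matrix.diagonal (fun i => ∏ l ∈ univ.erase i, (y l - y i)) := by
    ext i j
    rw [Matrix.diagonal_apply]
    split_ifs with h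
    · subst h; rfl
    · exact Finset.prod_eq_zero (mem_erase.2 ⟨h, mem_univ i⟩) (by simp)
  have h1 := congrArg Matrix.det (hN y)
  rw [hdiag, Matrix.det_diagonal, Matrix.det_mul, hV] at h1
  have h2 := congrArg abs h1
  rw [DAV_sq, abs_mul] at h2
  have hpos := DAV_pos hy
  have h3 := mul_left_cancel₀ (abs_pos.2 hpos.ne').ne' h2
  rw [hN u, Matrix.det_mul, hV, abs_mul, ← h3, abs_of_pos hpos]

noncomputable def DAM {k : ℕ} (x : Fin (k + 1) → ℝ) (y : Fin k → ℝ) : Matrix (Fin k) (Fin k) ℝ :=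
  Matrix.of fun i j => (∏ l ∈ univ.erase j, (y l - x i.succ)) / ∏ l, (x (i.succ.succAbove l) - x i.succ)

theorem DAM_det {k : ℕ} {x : Fin (k + 1) → ℝ} (hx : StrictMono x) {y : Fin k → ℝ}
    (hy : StrictMono y) : |(DAM x y).det| = DAV y / DAV x := by
  have hM : DAM x y = Matrix.of fun i j => (∏ l, (x (i.succ.succAbove l) - x i.succ))⁻¹ *
      (Matrix.of fun i j : Fin k => ∏ l ∈ univ.erase j, (y l - x i.succ)) i j := by
    ext i j
    simp [DAM, div_eq_inv_mul]
  rw [hM, Matrix.det_mul_column, abs_mul, DA_detN hy, Finset.prod_inv_distrib, abs_inv, DA_cprod hx]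
  have h1 := DAV_pos hx
  have h2 : 0 < DAV (fun j : Fin k => x j.succ) :=
    DAV_pos (fun a b hab => hx (Fin.succ_lt_succ_iff.2 hab))
  rw [abs_of_pos h2]
  field_simp

theorem DAphi_deriv {k : ℕ} (x : Fin (k + 1) → ℝ) (y : Fin k → ℝ) :
    HasFDerivAt (DAphi x) (Matrix.toLin' (DAM x y)).toContinuousLinearMap y := by
  rw [hasFDerivAt_pi']
  intro i
  have h1 : ∀ l ∈ (univ : Finset (Fin k)), HasFDerivAt (fun z : Fin k → ℝ => z l - x i.succ)
      (ContinuousLinearMap.proj (R := ℝ) (φ := fun _ : Fin k => ℝ) l) y := fun l _ =>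
    (ContinuousLinearMap.proj (R := ℝ) (φ := fun _ : Fin k => ℝ) l).hasFDerivAt.sub_const _
  have h2 := (HasFDerivAt.finsetProd h1).mul_const
    (∏ l, (x (i.succ.succAbove l) - x i.succ))⁻¹
  have h3 : (fun z => DAphi x z i) = fun z : Fin k → ℝ =>
      (∏ l, (z l - x i.succ)) * (∏ l, (x (i.succ.succAbove l) - x i.succ))⁻¹ := by
    funext z
    simp [DAphi, DAwt, Finset.prod_mul_distrib, div_eq_mul_inv]
  rw [h3]
  refine h2.congr_fderiv ?_
  ext v
  simp [DAM, Matrix.mulVec, dotProduct, Finset.mul_sum]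
  refine Finset.sum_congr rfl fun j _ => ?_
  ring

theorem DA_absprod {k : ℕ} {x : Fin (k + 1) → ℝ} (hx : StrictMono x) {y : Fin k → ℝ}
    (hy : y ∈ DAU x) :
    ∏ i : Fin k, ∏ j : Fin (k + 1), |y i - x j| = (∏ j, DAwt x y j) * (DAV x * DAV x) := by
  have h := DAV_sq x
  simp only [DA_erase] at h
  rw [abs_of_pos (DAV_pos hx)] at h
  rw [← h, Finset.prod_comm, Finset.abs_prod, ← Finset.prod_mul_distrib]
  refine Finset.prod_congr rfl fun j _ => ?_
  rw [← abs_of_pos (DAwt_pos hx hy j), ← abs_mul, DAwt, ← Finset.prod_mul_distrib, Finset.abs_prod]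
  refine Finset.prod_congr rfl fun l _ => ?_
  rw [div_mul_cancel₀ _ (DA_sA_ne hx j l)]

theorem DA_density {k : ℕ} (β : ℝ) {x : Fin (k + 1) → ℝ} (hx : StrictMono x)
    {y : Fin k → ℝ} (hy : y ∈ DAU x) :
    DAdensity k β x y = (Real.Gamma (β * (k + 1) / 2) / Real.Gamma (β / 2) ^ (k + 1)) *
      ((DAV y / DAV x) * ∏ j, (DAwt x y j) ^ (β / 2 - 1)) := by
  have hV := DAV_pos hx
  unfold DAdensity
  have h1 : (∏ i : Fin (k + 1), ∏ j ∈ Ioi i, (x j - x i) ^ (1 - β)) = DAV x ^ (1 - β) := by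
    unfold DAV
    rw [← Real.finsetProd_rpow _ _ (fun i _ => Finset.prod_nonneg fun j hj =>
      (sub_pos.2 (hx (mem_Ioi.1 hj))).le)]
    refine Finset.prod_congr rfl fun i _ => ?_
    rw [← Real.finsetProd_rpow _ _ (fun j hj => (sub_pos.2 (hx (mem_Ioi.1 hj))).le)]
  have h2 : (∏ i : Fin k, ∏ j : Fin (k + 1), |y i - x j| ^ (β / 2 - 1)) =
      (∏ j, (DAwt x y j) ^ (β / 2 - 1)) * (DAV x * DAV x) ^ (β / 2 - 1) := by
    have hp : ∀ j ∈ (univ : Finset (Fin (k+1))), 0 ≤ DAwt x y j := fun j _ => (DAwt_pos hx hy j).le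
    rw [Real.finsetProd_rpow _ _ hp, ← Real.mul_rpow (Finset.prod_nonneg hp) (by positivity),
      ← DA_absprod hx hy]
    rw [← Real.finsetProd_rpow _ _ (fun i _ => Finset.prod_nonneg fun j hj => abs_nonneg _)]
    refine Finset.prod_congr rfl fun i _ => ?_
    rw [← Real.finsetProd_rpow _ _ (fun j hj => abs_nonneg _)]
  have h3 : DAV x ^ (1 - β) * (DAV x * DAV x) ^ (β / 2 - 1) = (DAV x)⁻¹ := by
    rw [Real.mul_rpow hV.le hV.le, ← Real.rpow_add hV, ← Real.rpow_add hV, ← Real.rpow_neg_one]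
    congr 1
    ring
  rw [h1, h2, div_eq_mul_inv (DAV y), ← h3]
  unfold DAV
  ring

theorem DA_change {k : ℕ} (β : ℝ) {x : Fin (k + 1) → ℝ} (hx : StrictMono x)
    (f : (Fin k → ℝ) → ℝ) (g : (Fin (k+1) → ℝ) → ℝ) (hfg : ∀ y, f y = g (DAwt x y)) :
    (∫ y in DAdomain k x, DAdensity k β x y * f y) =
      (Real.Gamma (β * (k + 1) / 2) / Real.Gamma (β / 2) ^ (k + 1)) *
      ∫ w in DAS k, (∏ j, (DAW w j) ^ (β / 2 - 1)) * g (DAW w) := by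
  have hU : DAU x = Set.pi Set.univ fun i : Fin k => Set.Ioo (x i.castSucc) (x i.succ) := by
    ext y; simp [DAU, Set.mem_pi]
  have hUm : MeasurableSet (DAU x) := by
    rw [hU]; exact MeasurableSet.univ_pi fun i => measurableSet_Ioo
  have hD : (DAdomain k x) =ᵐ[volume] DAU x := by
    have h := Measure.univ_pi_Ioo_ae_eq_Icc (μ := fun _ : Fin k => (volume : Measure ℝ))
      (f := fun i : Fin k => x i.castSucc) (g := fun i : Fin k => x i.succ)
    have hD : DAdomain k x = Set.Icc (fun i : Fin k => x i.castSucc) (fun i : Fin k => x i.succ) := by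
      ext y; simp [DAdomain, Set.mem_Icc, Pi.le_def, forall_and]
    rw [hD, hU]
    exact h.symm
  rw [setIntegral_congr_set hD, ← DAphi_image hx,
    integral_image_eq_integral_abs_det_fderiv_smul volume hUm
      (fun y _ => (DAphi_deriv x y).hasFDerivWithinAt) (DAphi_inj hx), ← integral_const_mul]
  refine setIntegral_congr_fun hUm fun y hy => ?_
  have hym : StrictMono y := fun i j hij => DAU_mono hx hy hy hij
  have hdet : |((Matrix.toLin' (DAM x y)).toContinuousLinearMap).det| = DAV y / DAV x := by
    rw [← DAM_det hx hym]
    simp [ContinuousLinearMap.det]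
  simp only [DAW_phi hx, smul_eq_mul]
  rw [hdet, DA_density β hx hy, hfg]
  ring

/-- The Dixon–Anderson kernel maps symmetric polynomials in `k` variables to symmetric
polynomials in `k+1` variables without increasing the total degree: for any symmetric
polynomial `p` in `k` variables of total degree `d`, there is a symmetric polynomial `q`
in `k+1` variables of total degree at most `d` with
`∫_{W^{(k)}(x)} Λ^{(k)}(x,y) p(y) dy = q(x)` for all strictly increasing `x ∈ ℝ^{k+1}`. -/
theorem DA_kernel_maps_symmetric_polynomials (β : ℝ) (hβ : 0 < β) (k : ℕ) (hk : 1 ≤ k)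
    (P : MvPolynomial (Fin k) ℝ) (hP : P.IsSymmetric) :
    ∃ Q : MvPolynomial (Fin (k + 1)) ℝ, Q.IsSymmetric ∧
      Q.totalDegree ≤ P.totalDegree ∧
      ∀ x : Fin (k + 1) → ℝ, StrictMono x →
        (∫ y in DAdomain k x, DAdensity k β x y * MvPolynomial.eval y P) =
          MvPolynomial.eval x Q := by
  classical
  obtain ⟨F, hF, hFd⟩ := DA_exists_F k P hP
  have ha : -1 < β / 2 - 1 := by linarith
  set c : ℝ := Real.Gamma (β * (k + 1) / 2) / Real.Gamma (β / 2) ^ (k + 1) with hc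
  obtain ⟨Q, hQd, hQ⟩ := DA_mapRange (k+1) (DALin k (β / 2 - 1) ha c) (DAG (k+1) k F)
  have hQ' : ∀ x, MvPolynomial.eval x Q = c * ∫ w in DAS k, (∏ j, (DAW w j) ^ (β / 2 - 1)) *
      MvPolynomial.eval (fun i : Fin k => DAe (k+1) (i+1) (DAW w) x) F := by
    intro x
    rw [hQ, DALin_apply]
    simp only [DAG_eval]
  refine ⟨Q, ?_, hQd.trans (DAG_deg _ _ _ F hFd), ?_⟩
  · intro σ
    apply MvPolynomial.funext
    intro x
    rw [MvPolynomial.eval_rename, hQ', hQ']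
    congr 1
    rw [← DA_int_perm σ⁻¹ (fun W => (∏ j, (W j) ^ (β / 2 - 1)) *
      MvPolynomial.eval (fun i : Fin k => DAe (k+1) (i+1) W x) F)]
    refine integral_congr_ae (Filter.Eventually.of_forall fun w => ?_)
    have h1 : ∀ r, DAe (k+1) r (DAW w) (x ∘ σ) = DAe (k+1) r (DAW w ∘ ⇑σ⁻¹) x := by
      intro r
      rw [← DAe_perm (k+1) r (DAW w ∘ ⇑σ⁻¹) x σ]
      congr 1
      funext i
      simp
    have h2 : ∏ j, DAW w j ^ (β / 2 - 1) = ∏ j, (DAW w ∘ ⇑σ⁻¹) j ^ (β / 2 - 1) :=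
      (Equiv.prod_comp σ⁻¹ (fun j => DAW w j ^ (β / 2 - 1))).symm
    simp only [h1, h2]
  · intro x hx
    rw [hQ']
    refine DA_change β hx (fun y => MvPolynomial.eval y P)
      (fun W => MvPolynomial.eval (fun i : Fin k => DAe (k+1) (i+1) W x) F) ?_
    intro y
    have h1 : (fun i : Fin k => DAe (k+1) (i+1) (DAwt x y) x) =
        fun i : Fin k => MvPolynomial.eval y (MvPolynomial.esymm (Fin k) ℝ (i+1)) := by
      funext i
      rw [← DA_esymm_y hx y (i+1) (by omega)]
      simp [MvPolynomial.esymm]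
    have h2 := congrArg (MvPolynomial.eval y) hF
    rw [← h2, h1, MvPolynomial.map_aeval]
    have h3 : (MvPolynomial.eval y).comp (algebraMap ℝ (MvPolynomial (Fin k) ℝ)) = RingHom.id ℝ := by
      ext r; simp [MvPolynomial.algebraMap_eq]
    rw [h3]
    rfl
end

section
/- Fix β > 0, set θ = β/2, let k ≥ 1, and let p be a symmetric polynomial in k real variables of total degree d. Suppose u : [0,∞) × ℝ^k → ℝ satisfies: (i) for every t ≥ 0, u(t,·) is a symmetric polynomial in k variables of total degree at most d; (ii) for every z ∈ ℝ^k, t ↦ u(t,z) is continuously differentiable; (iii) u(0,·) = p; and (iv) for every t ≥ 0 and every z with pairwise distinct coordinates, ∂u/∂t(t,z) = (A^{(k)}u(t,·))(z). Suppose v : [0,∞) × ℝ^{k+1} → ℝ satisfies the analogous conditions in k+1 variables with degree at most d, with generator A^{(k+1)}, and with initial condition v(0,x) = ∫_{W^{(k)}(x)} Λ^{(k)}(x,y) p(y) dy for every strictly increasing x ∈ ℝ^{k+1}. Then for every t ≥ 0 and every strictly increasing x = (x_1 < … < x_{k+1}) ∈ ℝ^{k+1}, ∫_{W^{(k)}(x)}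 Λ^{(k)}(x,y) u(t,y) dy = v(t,x). -/
open Finset MeasureTheory

lemma fd_interp {M X : Type*} [AddCommGroup M] [Module ℝ M] [FiniteDimensional ℝ M]
    (φ : X → M →ₗ[ℝ] ℝ) (h : ∀ m, (∀ x, φ x m = 0) → m = 0) :
    ∃ (s : Finset X) (L : X → M), ∀ m, m = ∑ x ∈ s, φ x m • L x := by
  classical
  obtain ⟨s, -, hs⟩ := WellFounded.has_min
    (InvImage.wf (fun s : Finset X => Module.finrank ℝ
      (⨅ x ∈ s, LinearMap.ker (φ x) : Submodule ℝ M)) Nat.lt_wfRel.wf) Set.univ ⟨∅, trivial⟩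
  let T : M →ₗ[ℝ] (s → ℝ) := LinearMap.pi (fun i : s => φ i)
  have hT : LinearMap.ker T = ⊥ := by
    rw [LinearMap.ker_eq_bot']
    intro m hm
    apply h
    by_contra hx
    push Not at hx
    obtain ⟨x, hx⟩ := hx
    have hms : m ∈ (⨅ x ∈ s, LinearMap.ker (φ x) : Submodule ℝ M) := by
      simp only [Submodule.mem_iInf, LinearMap.mem_ker]
      intro i hi
      exact congrFun hm ⟨i, hi⟩
    apply hs (insert x s) trivial
    apply Submodule.finrank_lt_finrank_of_lt
    refine lt_of_le_of_ne ?_ ?_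
    · simp only [Finset.iInf_insert]
      exact inf_le_right
    · intro he
      rw [← he] at hms
      simp only [Finset.iInf_insert, Submodule.mem_inf] at hms
      exact hx hms.1
  obtain ⟨S, hS⟩ := T.exists_leftInverse_of_injective hT
  refine ⟨s, fun x => if hx : x ∈ s then S (Pi.single ⟨x, hx⟩ 1) else 0, fun m => ?_⟩
  have h1 : S (T m) = m := by
    have := congrArg (fun f => f m) hS
    simpa using this
  have h2 : T m = ∑ i : s, (φ i m) • (Pi.single i (1:ℝ) : s → ℝ) := by
    ext j
    simp [T, Finset.sum_apply, Pi.single_apply]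
  rw [h2, map_sum] at h1
  rw [← Finset.sum_coe_sort s]
  refine h1.symm.trans (Finset.sum_congr rfl fun i _ => ?_)
  rw [map_smul]
  simp

lemma ode_zero {E X : Type*} [AddCommGroup E] [Module ℝ E] [FiniteDimensional ℝ E]
    (φ ψ : X → E →ₗ[ℝ] ℝ) (hφ : ∀ m, (∀ x, φ x m = 0) → m = 0) (h : ℝ → E) (h0 : h 0 = 0)
    (hd : ∀ x, ∀ t : ℝ, 0 ≤ t →
      HasDerivWithinAt (fun s => φ x (h s)) (ψ x (h t)) (Set.Ici 0) t) :
    ∀ t : ℝ, 0 ≤ t → h t = 0 := by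
  classical
  obtain ⟨s, L, hL⟩ := fd_interp φ hφ
  let Y : ℝ → (s → ℝ) := fun t i => φ i (h t)
  let M : (s → ℝ) →ₗ[ℝ] (s → ℝ) :=
    LinearMap.pi fun i => ∑ j : s, (ψ i (L j)) • LinearMap.proj j
  have hM : ∀ t, M (Y t) = fun i : s => ψ i (h t) := by
    intro t
    ext i
    conv_rhs => rw [hL (h t), ← Finset.sum_coe_sort s, map_sum]
    simp [M, Y, mul_comm]
  have hY : ∀ t : ℝ, 0 ≤ t → HasDerivWithinAt Y (M (Y t)) (Set.Ici 0) t := by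
    intro t ht
    rw [hM, hasDerivWithinAt_pi]
    intro i
    exact hd i t ht
  intro T hT
  have key : Set.EqOn Y (fun _ => 0) (Set.Icc 0 T) := by
    refine ODE_solution_unique_of_mem_Icc_right (v := fun _ y => M y) (s := fun _ => Set.univ)
      (K := ‖LinearMap.toContinuousLinearMap M‖₊) ?_ ?_ ?_ ?_ ?_ ?_ ?_ ?_
    · intro t _
      exact (LinearMap.toContinuousLinearMap M).lipschitz.lipschitzOnWith
    · intro t ht
      exact ((hY t ht.1).continuousWithinAt).mono Set.Icc_subset_Ici_self
    · intro t ht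
      exact (hY t ht.1).mono (Set.Ici_subset_Ici.2 ht.1)
    · intro _ _; trivial
    · exact continuousOn_const
    · intro t ht
      simpa using (hasDerivWithinAt_const t (Set.Ici t) (0 : s → ℝ))
    · intro _ _; trivial
    · ext i; simp [Y, h0]
  rw [hL (h T)]
  refine Finset.sum_eq_zero fun i hi => ?_
  have := congrFun (key ⟨hT, le_refl T⟩) ⟨i, hi⟩
  have h2 : φ i (h T) = 0 := this
  rw [h2, zero_smul]

lemma pd2_eq {m : ℕ} (f : (Fin m → ℝ) → ℝ) (i : Fin m) (z : Fin m → ℝ) :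
    pd2 f i z = pd (fun w => pd f i w) i z := rfl

lemma pd_contDiff {m : ℕ} {f : (Fin m → ℝ) → ℝ} (hf : ContDiff ℝ 2 f) (i : Fin m) :
    ContDiff ℝ 1 (fun w => pd f i w) := by
  unfold pd
  exact (hf.fderiv_right (m := 1) (by norm_num)).clm_apply contDiff_const

lemma pd_diff {m : ℕ} {f : (Fin m → ℝ) → ℝ} (hf : ContDiff ℝ 2 f) (i : Fin m) :
    Differentiable ℝ (fun w => pd f i w) := (pd_contDiff hf i).differentiable (by norm_num)

lemma cd2_diff {m : ℕ} {f : (Fin m → ℝ) → ℝ} (hf : ContDiff ℝ 2 f) :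
    Differentiable ℝ f := hf.differentiable (by norm_num)

lemma pd_sum {m : ℕ} {ι : Type*} (s : Finset ι) (c : ι → ℝ) (f : ι → (Fin m → ℝ) → ℝ)
    (hf : ∀ a ∈ s, Differentiable ℝ (f a)) (i : Fin m) (z : Fin m → ℝ) :
    pd (fun z => ∑ a ∈ s, c a * f a z) i z = ∑ a ∈ s, c a * pd (f a) i z := by
  unfold pd
  rw [fderiv_fun_sum (fun a ha => ((hf a ha) z).const_mul (c a))]
  rw [_root_.sum_apply]
  refine Finset.sum_congr rfl fun a ha => ?_
  rw [fderiv_const_mul ((hf a ha) z)]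
  simp

lemma pd2_sum {m : ℕ} {ι : Type*} (s : Finset ι) (c : ι → ℝ) (f : ι → (Fin m → ℝ) → ℝ)
    (hf : ∀ a ∈ s, ContDiff ℝ 2 (f a)) (i : Fin m) (z : Fin m → ℝ) :
    pd2 (fun z => ∑ a ∈ s, c a * f a z) i z = ∑ a ∈ s, c a * pd2 (f a) i z := by
  rw [pd2_eq]
  have : (fun w => pd (fun z => ∑ a ∈ s, c a * f a z) i w) =
      fun w => ∑ a ∈ s, c a * pd (f a) i w := by
    ext w; exact pd_sum s c f (fun a ha => cd2_diff (hf a ha)) i w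
  rw [this, pd_sum s c (fun a w => pd (f a) i w) (fun a ha => pd_diff (hf a ha) i)]
  rfl

lemma genA_sum {m : ℕ} {ι : Type*} (θ : ℝ) (s : Finset ι) (c : ι → ℝ) (f : ι → (Fin m → ℝ) → ℝ)
    (hf : ∀ a ∈ s, ContDiff ℝ 2 (f a)) (z : Fin m → ℝ) :
    genA θ (fun z => ∑ a ∈ s, c a * f a z) z = ∑ a ∈ s, c a * genA θ (f a) z := by
  unfold genA
  simp_rw [pd2_sum s c f hf, pd_sum s c f (fun a ha => cd2_diff (hf a ha))]
  simp_rw [Finset.mul_sum, mul_add, Finset.sum_add_distrib, Finset.mul_sum]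
  congr 1
  · rw [Finset.sum_comm]
    refine Finset.sum_congr rfl fun a _ => Finset.sum_congr rfl fun i _ => by ring
  · have : ∀ i : Fin m, ∑ j ∈ univ.erase i, ∑ a ∈ s, θ * (1 / (z i - z j) * (c a * pd (f a) i z))
        = ∑ a ∈ s, ∑ j ∈ univ.erase i, θ * (1 / (z i - z j) * (c a * pd (f a) i z)) :=
      fun i => Finset.sum_comm
    simp_rw [this]
    rw [Finset.sum_comm]
    refine Finset.sum_congr rfl fun a _ => Finset.sum_congr rfl fun i _ =>
      Finset.sum_congr rfl fun j _ => by ring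

lemma genA_add {m : ℕ} (θ : ℝ) (f g : (Fin m → ℝ) → ℝ)
    (hf : ContDiff ℝ 2 f) (hg : ContDiff ℝ 2 g) (z : Fin m → ℝ) :
    genA θ (fun z => f z + g z) z = genA θ f z + genA θ g z := by
  have := genA_sum θ (univ : Finset (Fin 2)) (fun _ => 1) ![f, g]
    (by intro a _; fin_cases a <;> simpa) z
  simpa using this

lemma genA_const_mul {m : ℕ} (θ c : ℝ) (f : (Fin m → ℝ) → ℝ)
    (hf : ContDiff ℝ 2 f) (z : Fin m → ℝ) :
    genA θ (fun z => c * f z) z = c * genA θ f z := by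
  have := genA_sum θ (univ : Finset (Fin 1)) (fun _ => c) ![f]
    (by intro a _; fin_cases a; simpa) z
  simpa using this

lemma pd_mul {m : ℕ} {f g : (Fin m → ℝ) → ℝ} (hf : Differentiable ℝ f)
    (hg : Differentiable ℝ g) (i : Fin m) (z : Fin m → ℝ) :
    pd (fun z => f z * g z) i z = f z * pd g i z + g z * pd f i z := by
  unfold pd
  rw [fderiv_fun_mul (hf z) (hg z)]
  simp

lemma pd_add {m : ℕ} {f g : (Fin m → ℝ) → ℝ} (hf : Differentiable ℝ f)
    (hg : Differentiable ℝ g) (i : Fin m) (z : Fin m → ℝ) :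
    pd (fun z => f z + g z) i z = pd f i z + pd g i z := by
  unfold pd
  rw [fderiv_fun_add (hf z) (hg z)]
  simp

lemma pd2_mul {m : ℕ} {f g : (Fin m → ℝ) → ℝ} (hf : ContDiff ℝ 2 f)
    (hg : ContDiff ℝ 2 g) (i : Fin m) (z : Fin m → ℝ) :
    pd2 (fun z => f z * g z) i z =
      f z * pd2 g i z + g z * pd2 f i z + 2 * (pd f i z * pd g i z) := by
  have : (fun w => pd (fun z => f z * g z) i w) =
      fun w => f w * pd g i w + g w * pd f i w := by
    ext w; exact pd_mul (cd2_diff hf) (cd2_diff hg) i w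
  rw [pd2_eq, this, pd_add ((cd2_diff hf).fun_mul (pd_diff hg i)) ((cd2_diff hg).fun_mul (pd_diff hf i)),
    pd_mul (cd2_diff hf) (pd_diff hg i), pd_mul (cd2_diff hg) (pd_diff hf i), pd2_eq, pd2_eq]
  ring

lemma genA_mul {m : ℕ} (θ : ℝ) {f g : (Fin m → ℝ) → ℝ} (hf : ContDiff ℝ 2 f)
    (hg : ContDiff ℝ 2 g) (z : Fin m → ℝ) :
    genA θ (fun z => f z * g z) z =
      f z * genA θ g z + g z * genA θ f z + ∑ i, pd f i z * pd g i z := by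
  unfold genA
  simp_rw [pd2_mul hf hg, pd_mul (cd2_diff hf) (cd2_diff hg), Finset.sum_add_distrib,
    mul_add, Finset.sum_add_distrib]
  simp only [mul_add, Finset.mul_sum]
  have e1 : ∀ F : Fin m → ℝ, ∑ i, 1 / 2 * (2 * F i) = ∑ i, F i := fun F =>
    Finset.sum_congr rfl fun i _ => by ring
  rw [e1]
  have e2 : ∀ (a : ℝ) (F : Fin m → ℝ), ∑ i, 1 / 2 * (a * F i) = ∑ i, a * (1 / 2 * F i) := fun a F =>
    Finset.sum_congr rfl fun i _ => by ring
  have e3 : ∀ (a : ℝ) (F G : Fin m → ℝ),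
      ∑ i, ∑ j ∈ univ.erase i, θ * (1 / (z i - z j) * (a * F i)) =
      ∑ i, ∑ j ∈ univ.erase i, a * (θ * (1 / (z i - z j) * (F i))) := fun a F G =>
    Finset.sum_congr rfl fun i _ => Finset.sum_congr rfl fun j _ => by ring
  rw [e2, e2, e3 _ _ 0, e3 _ _ 0]
  ring

lemma pd_const {m : ℕ} (c : ℝ) (i : Fin m) (z : Fin m → ℝ) :
    pd (fun _ => c) i z = 0 := by
  unfold pd; simp

lemma genA_const {m : ℕ} (θ c : ℝ) (z : Fin m → ℝ) :
    genA θ (fun _ => c) z = 0 := by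
  unfold genA
  simp_rw [pd2_eq, pd_const]
  simp

lemma pd_prod {m : ℕ} {ι : Type*} [DecidableEq ι] (B : Finset ι) (f : ι → (Fin m → ℝ) → ℝ)
    (hf : ∀ a, ContDiff ℝ 2 (f a)) (i : Fin m) (z : Fin m → ℝ) :
    pd (fun z => ∏ a ∈ B, f a z) i z = ∑ a ∈ B, pd (f a) i z * ∏ b ∈ B.erase a, f b z := by
  induction B using Finset.induction_on with
  | empty => simp [pd_const]
  | insert a B ha ih =>
    simp_rw [Finset.prod_insert ha]
    rw [pd_mul (cd2_diff (hf a)) (cd2_diff (contDiff_prod fun b _ => hf b)), ih,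
      Finset.sum_insert ha, Finset.erase_insert ha, add_comm, mul_comm, Finset.mul_sum]
    congr 1
    refine Finset.sum_congr rfl fun b hb => ?_
    have hab : a ≠ b := fun h => ha (h ▸ hb)
    rw [Finset.erase_insert_of_ne hab, Finset.prod_insert (fun h => ha (Finset.mem_of_mem_erase h))]
    ring

lemma genA_prod {m : ℕ} {ι : Type*} [DecidableEq ι] (θ : ℝ) (B : Finset ι)
    (f : ι → (Fin m → ℝ) → ℝ)
    (hf : ∀ a, ContDiff ℝ 2 (f a)) (z : Fin m → ℝ) :
    genA θ (fun z => ∏ a ∈ B, f a z) z =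
      ∑ a ∈ B, genA θ (f a) z * ∏ b ∈ B.erase a, f b z +
      1 / 2 * ∑ a ∈ B, ∑ b ∈ B.erase a, (∑ i, pd (f a) i z * pd (f b) i z) *
        ∏ c ∈ (B.erase a).erase b, f c z := by
  induction B using Finset.induction_on with
  | empty => simp [genA_const]
  | insert a B ha ih =>
    simp_rw [Finset.prod_insert ha]
    rw [genA_mul θ (hf a) (contDiff_prod fun b _ => hf b), ih]
    simp_rw [pd_prod B f hf]
    rw [Finset.sum_insert ha, Finset.sum_insert ha, Finset.erase_insert ha]
    have h1 : ∀ b ∈ B, ∏ c ∈ (insert a B).erase b, f c z = f a z * ∏ c ∈ B.erase b, f c z := by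
      intro b hb
      have hab : a ≠ b := fun h => ha (h ▸ hb)
      rw [Finset.erase_insert_of_ne hab,
        Finset.prod_insert (fun h => ha (Finset.mem_of_mem_erase h))]
    have h2 : ∀ b ∈ B, ∑ c ∈ (insert a B).erase b, (∑ i, pd (f b) i z * pd (f c) i z) *
          ∏ d ∈ ((insert a B).erase b).erase c, f d z =
        (∑ i, pd (f a) i z * pd (f b) i z) * ∏ d ∈ B.erase b, f d z +
        f a z * ∑ c ∈ B.erase b, (∑ i, pd (f b) i z * pd (f c) i z) *
          ∏ d ∈ (B.erase b).erase c, f d z := by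
      intro b hb
      have hab : a ≠ b := fun h => ha (h ▸ hb)
      have hab' : a ∉ B.erase b := fun h => ha (Finset.mem_of_mem_erase h)
      rw [Finset.erase_insert_of_ne hab, Finset.sum_insert hab', Finset.erase_insert hab',
        Finset.mul_sum]
      congr 1
      · congr 1
        exact Finset.sum_congr rfl fun i _ => mul_comm _ _
      refine Finset.sum_congr rfl fun c hc => ?_
      have hac : a ≠ c := fun h => hab' (h ▸ hc)
      rw [Finset.erase_insert_of_ne hac,
        Finset.prod_insert (fun h => hab' (Finset.mem_of_mem_erase h))]
      ring
    have h5 := Finset.sum_congr (f := fun b => _) rfl h2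
    rw [h5]
    have h3 : ∑ i, pd (f a) i z * ∑ b ∈ B, pd (f b) i z * ∏ c ∈ B.erase b, f c z =
        ∑ b ∈ B, (∑ i, pd (f a) i z * pd (f b) i z) * ∏ d ∈ B.erase b, f d z := by
      simp_rw [Finset.mul_sum, Finset.sum_mul]
      rw [Finset.sum_comm]
      refine Finset.sum_congr rfl fun b _ => Finset.sum_congr rfl fun i _ => by ring
    rw [h3, Finset.sum_add_distrib]
    have h4 : ∑ x ∈ B, genA θ (f x) z * ∏ c ∈ (insert a B).erase x, f c z =
        f a z * ∑ x ∈ B, genA θ (f x) z * ∏ c ∈ B.erase x, f c z := by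
      rw [Finset.mul_sum]
      exact Finset.sum_congr rfl fun b hb => by rw [h1 b hb]; ring
    rw [h4, ← Finset.mul_sum]
    ring

lemma pd_of_update {m : ℕ} {f : (Fin m → ℝ) → ℝ} {i : Fin m} {z : Fin m → ℝ} {d : ℝ}
    (hf : DifferentiableAt ℝ f z)
    (h : HasDerivAt (fun t => f (Function.update z i t)) d (z i)) : pd f i z = d := by
  have h1 : HasDerivAt (fun t => Function.update z i t) (Pi.single i 1) (z i) :=
    hasDerivAt_update z i (z i)
  have h2 : HasFDerivAt f (fderiv ℝ f z) (Function.update z i (z i)) := by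
    rw [Function.update_eq_self]; exact hf.hasFDerivAt
  have h3 := h2.comp_hasDerivAt (z i) h1
  exact h3.unique h

noncomputable def PS {m : ℕ} (x : Fin m → ℝ) (s : Finset (Fin m)) : Polynomial ℝ :=
  ∏ l ∈ s, (Polynomial.X - Polynomial.C (x l))

noncomputable def FP {m : ℕ} (c : ℝ) (g x : Fin m → ℝ) : Polynomial ℝ :=
  Polynomial.C c * PS x univ + ∑ j, Polynomial.C (g j) * PS x (univ.erase j)

noncomputable def pdF {m : ℕ} (c : ℝ) (g x : Fin m → ℝ) (i : Fin m) (w : ℝ) : ℝ :=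
  -(c * (PS x (univ.erase i)).eval w +
    ∑ j ∈ univ.erase i, g j * (PS x ((univ.erase j).erase i)).eval w)

lemma PS_eval {m : ℕ} (x : Fin m → ℝ) (s : Finset (Fin m)) (w : ℝ) :
    (PS x s).eval w = ∏ l ∈ s, (w - x l) := by
  simp [PS, Polynomial.eval_prod]

lemma FP_eval {m : ℕ} (c : ℝ) (g x : Fin m → ℝ) (w : ℝ) :
    (FP c g x).eval w = c * (PS x univ).eval w + ∑ j, g j * (PS x (univ.erase j)).eval w := by
  simp [FP, Polynomial.eval_finsetSum]

lemma PS_update {m : ℕ} (x : Fin m → ℝ) (s : Finset (Fin m)) (i : Fin m) (t : ℝ) (hi : i ∉ s) :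
    PS (Function.update x i t) s = PS x s := by
  unfold PS
  refine Finset.prod_congr rfl fun l hl => ?_
  rw [Function.update_of_ne (by rintro rfl; exact hi hl)]

lemma PS_update' {m : ℕ} (x : Fin m → ℝ) (s : Finset (Fin m)) (i : Fin m) (t w : ℝ) (hi : i ∈ s) :
    (PS (Function.update x i t) s).eval w = (w - t) * (PS x (s.erase i)).eval w := by
  rw [← PS_update x (s.erase i) i t (Finset.notMem_erase i s)]
  rw [PS_eval, PS_eval, ← Finset.mul_prod_erase s _ hi]
  simp

lemma PS_contDiff {m : ℕ} (s : Finset (Fin m)) (w : ℝ) :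
    ContDiff ℝ 2 (fun x : Fin m → ℝ => (PS x s).eval w) := by
  simp_rw [PS_eval]
  fun_prop

lemma FP_contDiff {m : ℕ} (c : ℝ) (g : Fin m → ℝ) (w : ℝ) :
    ContDiff ℝ 2 (fun x : Fin m → ℝ => (FP c g x).eval w) := by
  simp_rw [FP_eval, PS_eval]
  fun_prop

lemma FP_update {m : ℕ} (c : ℝ) (g x : Fin m → ℝ) (i : Fin m) (t w : ℝ) :
    (FP c g (Function.update x i t)).eval w =
      (t - w) * pdF c g x i w + g i * (PS x (univ.erase i)).eval w := by
  rw [FP_eval, PS_update' _ _ _ _ _ (Finset.mem_univ i),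
    ← Finset.add_sum_erase _ _ (Finset.mem_univ i), PS_update _ _ _ _ (Finset.notMem_erase _ _)]
  have : ∀ j ∈ univ.erase i, g j * (PS (Function.update x i t) (univ.erase j)).eval w =
      (w - t) * (g j * (PS x ((univ.erase j).erase i)).eval w) := by
    intro j hj
    rw [PS_update' _ _ _ _ _ (by
      rw [Finset.mem_erase] at *; exact ⟨fun h => hj.1 h.symm, Finset.mem_univ _⟩)]
    ring
  rw [Finset.sum_congr rfl this, ← Finset.mul_sum, pdF]
  ring

lemma pd_FP {m : ℕ} (c : ℝ) (g x : Fin m → ℝ) (i : Fin m) (w : ℝ) :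
    pd (fun x => (FP c g x).eval w) i x = pdF c g x i w := by
  apply pd_of_update (cd2_diff (FP_contDiff c g w) x)
  simp_rw [FP_update]
  have := (((hasDerivAt_id (x i)).sub_const w).mul_const (pdF c g x i w)).add_const
    (g i * (PS x (univ.erase i)).eval w)
  simpa using this

lemma pd2_FP {m : ℕ} (c : ℝ) (g x : Fin m → ℝ) (i : Fin m) (w : ℝ) :
    pd2 (fun x => (FP c g x).eval w) i x = 0 := by
  rw [pd2_eq]
  apply pd_of_update (pd_diff (FP_contDiff c g w) i x)
  simp_rw [pd_FP]
  have : ∀ t, pdF c g (Function.update x i t) i w = pdF c g x i w := by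
    intro t
    unfold pdF
    rw [PS_update _ _ _ _ (Finset.notMem_erase _ _)]
    simp_rw [PS_update x _ i t (Finset.notMem_erase i _)]
  simp_rw [this]
  exact hasDerivAt_const _ _

lemma PS_deriv {m : ℕ} (x : Fin m → ℝ) (s : Finset (Fin m)) (w : ℝ) (hw : ∀ l, w ≠ x l) :
    (PS x s).derivative.eval w = (PS x s).eval w * ∑ l ∈ s, (w - x l)⁻¹ ∧
    (PS x s).derivative.derivative.eval w =
      (PS x s).eval w * ((∑ l ∈ s, (w - x l)⁻¹) ^ 2 - ∑ l ∈ s, ((w - x l)⁻¹) ^ 2) := by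
  induction s using Finset.induction_on with
  | empty => simp [PS]
  | insert a s ha ih =>
    have h1 : PS x (insert a s) = (Polynomial.X - Polynomial.C (x a)) * PS x s := by
      simp [PS, Finset.prod_insert ha]
    have h2 : (w - x a) * (w - x a)⁻¹ = 1 := mul_inv_cancel₀ (sub_ne_zero.2 (hw a))
    rw [h1, Finset.sum_insert ha, Finset.sum_insert ha]
    simp only [Polynomial.derivative_mul, Polynomial.derivative_sub, Polynomial.derivative_X,
      Polynomial.derivative_C, Polynomial.eval_add, Polynomial.eval_mul, Polynomial.eval_sub,
      Polynomial.eval_X, Polynomial.eval_C, Polynomial.derivative_add, sub_zero, one_mul,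
      Polynomial.derivative_one]
    rw [ih.1, ih.2]
    constructor
    · linear_combination (-(PS x s).eval w) * h2
    · linear_combination (-2 * (PS x s).eval w * (∑ l ∈ s, (w - x l)⁻¹)) * h2

lemma PS_erase_gen {m : ℕ} (x : Fin m → ℝ) (s : Finset (Fin m)) (w : ℝ) (hw : ∀ l, w ≠ x l)
    (i : Fin m) (hi : i ∈ s) :
    (PS x (s.erase i)).eval w = (PS x s).eval w * (w - x i)⁻¹ := by
  have h2 : (w - x i) ≠ 0 := (sub_ne_zero.2 (hw i))
  rw [PS_eval, PS_eval, ← Finset.mul_prod_erase s _ hi]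
  field_simp

lemma sum_erase_eq {m : ℕ} (F : Fin m → ℝ) (i : Fin m) :
    ∑ j ∈ univ.erase i, F j = ∑ j, F j - F i := by
  rw [← Finset.add_sum_erase _ _ (Finset.mem_univ i)]; ring

lemma sum_antisymm {m : ℕ} (E : Fin m → Fin m → ℝ) (h : ∀ i j, i ≠ j → E i j + E j i = 0) :
    ∑ i, ∑ j ∈ univ.erase i, E i j = 0 := by
  have h1 : ∀ F : Fin m → Fin m → ℝ, ∑ i, ∑ j ∈ univ.erase i, F i j =
      ∑ i, ∑ j, if i = j then 0 else F i j := by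
    intro F
    refine Finset.sum_congr rfl fun i _ => ?_
    rw [← Finset.add_sum_erase _ (fun j => if i = j then 0 else F i j) (Finset.mem_univ i)]
    simp only [if_true, zero_add]
    refine Finset.sum_congr rfl fun j hj => ?_
    rw [if_neg (fun h => (Finset.mem_erase.1 hj).1 h.symm)]
  have h2 : ∑ i, ∑ j ∈ univ.erase i, E i j = ∑ i, ∑ j ∈ univ.erase i, E j i := by
    rw [h1, h1 (fun i j => E j i), Finset.sum_comm]
    refine Finset.sum_congr rfl fun i _ => Finset.sum_congr rfl fun j _ => ?_
    by_cases hij : i = j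
    · simp [hij]
    · rw [if_neg hij, if_neg (Ne.symm hij)]
  have h3 : ∑ i, ∑ j ∈ univ.erase i, E i j + ∑ i, ∑ j ∈ univ.erase i, E j i = 0 := by
    rw [← Finset.sum_add_distrib]
    refine Finset.sum_eq_zero fun i _ => ?_
    rw [← Finset.sum_add_distrib]
    refine Finset.sum_eq_zero fun j hj => ?_
    exact h i j (fun h => (Finset.mem_erase.1 hj).1 h.symm)
  linarith

section generic
variable {m : ℕ} (c : ℝ) (g x : Fin m → ℝ) (w : ℝ)

lemma FP_gen (hw : ∀ l, w ≠ x l) :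
    (FP c g x).eval w = (PS x univ).eval w * (c + ∑ j, g j * (w - x j)⁻¹) := by
  rw [FP_eval, mul_add, Finset.mul_sum, mul_comm c]
  congr 1
  refine Finset.sum_congr rfl fun j _ => ?_
  rw [PS_erase_gen x univ w hw j (Finset.mem_univ j)]; ring

lemma pdF_gen (hw : ∀ l, w ≠ x l) (i : Fin m) :
    pdF c g x i w = -((PS x univ).eval w * (w - x i)⁻¹ *
      ((c + ∑ j, g j * (w - x j)⁻¹) - g i * (w - x i)⁻¹)) := by
  unfold pdF
  have : ∀ j ∈ univ.erase i, g j * (PS x ((univ.erase j).erase i)).eval w =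
      (PS x univ).eval w * (w - x i)⁻¹ * (g j * (w - x j)⁻¹) := by
    intro j hj
    rw [PS_erase_gen x _ w hw i (by
      rw [Finset.mem_erase] at *; exact ⟨fun h => hj.1 h.symm, Finset.mem_univ _⟩),
      PS_erase_gen x _ w hw j (Finset.mem_univ _)]
    ring
  rw [Finset.sum_congr rfl this, ← Finset.mul_sum, sum_erase_eq,
    PS_erase_gen x _ w hw i (Finset.mem_univ _)]
  ring

lemma FP_deriv_gen (hw : ∀ l, w ≠ x l) :
    (FP c g x).derivative.eval w = (PS x univ).eval w *
      ((c + ∑ j, g j * (w - x j)⁻¹) * (∑ j, (w - x j)⁻¹) - ∑ j, g j * ((w - x j)⁻¹) ^ 2) := by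
  simp only [FP, Polynomial.derivative_add, Polynomial.derivative_sum, Polynomial.derivative_mul,
    Polynomial.derivative_C, zero_mul, zero_add, Polynomial.eval_add, Polynomial.eval_mul,
    Polynomial.eval_C, Polynomial.eval_finsetSum, (PS_deriv x _ w hw).1, sum_erase_eq]
  have : ∀ j ∈ univ, g j * ((PS x (univ.erase j)).eval w * ((∑ l, (w - x l)⁻¹) - (w - x j)⁻¹)) =
      (PS x univ).eval w * ((∑ l, (w - x l)⁻¹) * (g j * (w - x j)⁻¹) - g j * ((w - x j)⁻¹) ^ 2) := by
    intro j _
    rw [PS_erase_gen x _ w hw j (Finset.mem_univ _)]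
    ring
  rw [Finset.sum_congr rfl this, ← Finset.mul_sum, Finset.sum_sub_distrib, ← Finset.mul_sum]
  ring

lemma FP_deriv2_gen (hw : ∀ l, w ≠ x l) :
    (FP c g x).derivative.derivative.eval w = ∑ i, ∑ j ∈ univ.erase i, (PS x univ).eval w *
      ((c + ∑ j, g j * (w - x j)⁻¹) * ((w - x i)⁻¹ * (w - x j)⁻¹) -
        2 * (g i * ((w - x i)⁻¹) ^ 2 * (w - x j)⁻¹)) := by
  simp only [FP, Polynomial.derivative_add, Polynomial.derivative_sum, Polynomial.derivative_mul,
    Polynomial.derivative_C, zero_mul, zero_add, Polynomial.eval_add, Polynomial.eval_mul,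
    Polynomial.eval_C, Polynomial.eval_finsetSum, (PS_deriv x _ w hw).2, sum_erase_eq]
  set S := c + ∑ j, g j * (w - x j)⁻¹ with hS
  set σ := ∑ l, (w - x l)⁻¹ with hσ
  set τ := ∑ l, ((w - x l)⁻¹) ^ 2 with hτ
  have : ∀ j ∈ univ, g j * ((PS x (univ.erase j)).eval w *
      ((σ - (w - x j)⁻¹) ^ 2 - (τ - ((w - x j)⁻¹) ^ 2))) =
      (PS x univ).eval w * ((g j * (w - x j)⁻¹) * (σ ^ 2 - τ) - 2 *
        (g j * ((w - x j)⁻¹) ^ 2 * (σ - (w - x j)⁻¹))) := by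
    intro j _
    rw [PS_erase_gen x _ w hw j (Finset.mem_univ _)]
    ring
  rw [Finset.sum_congr rfl this]
  simp_rw [← Finset.mul_sum, Finset.sum_sub_distrib, ← Finset.mul_sum, ← hσ, ← Finset.sum_mul]
  have e1 : ∑ i, ((S * ((w - x i)⁻¹ * σ) - 2 * (g i * ((w - x i)⁻¹) ^ 2 * σ)) -
      (S * ((w - x i)⁻¹ * (w - x i)⁻¹) - 2 * (g i * ((w - x i)⁻¹) ^ 2 * (w - x i)⁻¹))) =
      S * (σ ^ 2 - τ) - 2 * ∑ j, g j * ((w - x j)⁻¹) ^ 2 * (σ - (w - x j)⁻¹) := by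
    rw [hτ, Finset.mul_sum, mul_sub, Finset.mul_sum]
    have : S * σ ^ 2 = ∑ i, S * σ * (w - x i)⁻¹ := by rw [← Finset.mul_sum, ← hσ]; ring
    rw [this, ← Finset.sum_sub_distrib, ← Finset.sum_sub_distrib]
    refine Finset.sum_congr rfl fun i _ => by ring
  simp_rw [Finset.sum_sub_distrib] at e1 ⊢
  rw [← mul_sub, e1, hS]
  ring

lemma drift_gen (hx : Function.Injective x) (hw : ∀ l, w ≠ x l) :
    ∑ i, ∑ j ∈ univ.erase i, (1 / (x i - x j)) * pdF c g x i w =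
      -(1 / 2) * (FP c g x).derivative.derivative.eval w +
      1 / 2 * ∑ i, ∑ j ∈ univ.erase i, (g i - g j) / (x i - x j) *
        (PS x ((univ.erase i).erase j)).eval w := by
  rw [FP_deriv2_gen c g x w hw]
  have h1 : ∀ i ∈ univ, ∑ j ∈ univ.erase i, (g i - g j) / (x i - x j) *
        (PS x ((univ.erase i).erase j)).eval w =
        ∑ j ∈ univ.erase i, (g i - g j) / (x i - x j) *
        ((PS x univ).eval w * ((w - x i)⁻¹ * (w - x j)⁻¹)) := by
    intro i _
    refine Finset.sum_congr rfl fun j hj => ?_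
    rw [PS_erase_gen x _ w hw j hj, PS_erase_gen x _ w hw i (Finset.mem_univ _)]
    ring
  rw [Finset.sum_congr rfl h1, Finset.mul_sum, Finset.mul_sum, ← sub_eq_zero]
  simp_rw [Finset.mul_sum, pdF_gen c g x w hw]
  rw [← Finset.sum_add_distrib, ← Finset.sum_sub_distrib]
  simp_rw [← Finset.sum_add_distrib, ← Finset.sum_sub_distrib]
  apply sum_antisymm
  intro i j hij
  generalize c + ∑ j, g j * (w - x j)⁻¹ = S
  generalize (PS x univ).eval w = Q
  have hi := sub_ne_zero.2 (hw i)
  have hj := sub_ne_zero.2 (hw j)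
  have h3 : x i - x j ≠ 0 := sub_ne_zero.2 (fun h => hij (hx h))
  have h4 : x j - x i ≠ 0 := sub_ne_zero.2 (fun h => hij (hx h).symm)
  have h5 : x j - x i = -(x i - x j) := by ring
  rw [h5]
  have h6 : (w - x i)⁻¹ - (w - x j)⁻¹ = (x i - x j) * ((w - x i)⁻¹ * (w - x j)⁻¹) := by
    field_simp; ring
  generalize (w - x i)⁻¹ = a at *
  generalize (w - x j)⁻¹ = b at *
  generalize hD : x i - x j = D at *
  field_simp
  linear_combination (-2 * Q * S + 2 * Q * (g i * a + g j * b)) * h6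

lemma gamma_gen (v : ℝ) (hw : ∀ l, w ≠ x l) (hv : ∀ l, v ≠ x l) :
    (w - v) * (∑ i, pdF c g x i w * pdF c g x i v + ∑ i, ∑ j ∈ univ.erase i, g i * g j *
        ((PS x ((univ.erase i).erase j)).eval w * (PS x ((univ.erase i).erase j)).eval v)) =
      (FP c g x).eval w * (FP c g x).derivative.eval v -
        (FP c g x).derivative.eval w * (FP c g x).eval v := by
  rw [FP_deriv_gen c g x w hw, FP_deriv_gen c g x v hv, FP_gen c g x w hw, FP_gen c g x v hv]
  have h1 : ∀ i ∈ univ, ∑ j ∈ univ.erase i, g i * g j *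
        ((PS x ((univ.erase i).erase j)).eval w * (PS x ((univ.erase i).erase j)).eval v) =
        ∑ j ∈ univ.erase i, (PS x univ).eval w * (PS x univ).eval v *
        ((g i * (w - x i)⁻¹ * (v - x i)⁻¹) * (g j * (w - x j)⁻¹ * (v - x j)⁻¹)) := by
    intro i _
    refine Finset.sum_congr rfl fun j hj => ?_
    rw [PS_erase_gen x _ w hw j hj, PS_erase_gen x _ w hw i (Finset.mem_univ _),
      PS_erase_gen x _ v hv j hj, PS_erase_gen x _ v hv i (Finset.mem_univ _)]
    ring
  rw [Finset.sum_congr rfl h1]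
  simp_rw [pdF_gen c g x w hw, pdF_gen c g x v hv, sum_erase_eq, Finset.sum_sub_distrib,
    ← Finset.mul_sum, ← Finset.sum_mul]
  have hab : ∀ i, (w - v) * ((w - x i)⁻¹ * (v - x i)⁻¹) = (v - x i)⁻¹ - (w - x i)⁻¹ := by
    intro i
    have hi := sub_ne_zero.2 (hw i)
    have hj := sub_ne_zero.2 (hv i)
    field_simp; ring
  have hST : (c + ∑ j, g j * (w - x j)⁻¹) - (c + ∑ j, g j * (v - x j)⁻¹) =
      -((w - v) * ∑ i, g i * (w - x i)⁻¹ * (v - x i)⁻¹) := by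
    rw [Finset.mul_sum, add_sub_add_left_eq_sub, ← Finset.sum_sub_distrib, ← Finset.sum_neg_distrib]
    refine Finset.sum_congr rfl fun i _ => ?_
    linear_combination g i * hab i
  generalize (c + ∑ j, g j * (w - x j)⁻¹) = S at *
  generalize (c + ∑ j, g j * (v - x j)⁻¹) = T at *
  generalize (PS x univ).eval w = Q
  generalize (PS x univ).eval v = Q'
  have h2 : (w - v) * (∑ i, -(Q * (w - x i)⁻¹ * (S - g i * (w - x i)⁻¹)) *
      -(Q' * (v - x i)⁻¹ * (T - g i * (v - x i)⁻¹))) =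
      Q * Q' * (S * T * (∑ i, (v - x i)⁻¹ - ∑ i, (w - x i)⁻¹) -
        S * ∑ i, g i * ((v - x i)⁻¹) ^ 2 + T * ∑ i, g i * ((w - x i)⁻¹) ^ 2 +
        (S - T) * ∑ i, g i * (w - x i)⁻¹ * (v - x i)⁻¹ +
        (w - v) * ∑ i, (g i * (w - x i)⁻¹ * (v - x i)⁻¹) * (g i * (w - x i)⁻¹ * (v - x i)⁻¹)) := by
    simp only [Finset.mul_sum, ← Finset.sum_sub_distrib, ← Finset.sum_add_distrib]
    refine Finset.sum_congr rfl fun i _ => ?_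
    linear_combination (Q * Q' * (S * T - S * (g i * (v - x i)⁻¹) - T * (g i * (w - x i)⁻¹))) * hab i
  rw [mul_add, h2]
  linear_combination (Q * Q' * ∑ i, g i * (w - x i)⁻¹ * (v - x i)⁻¹) * hST

end generic

lemma dense_gen {m : ℕ} (x : Fin m → ℝ) : Dense {w : ℝ | ∀ l, w ≠ x l} := by
  have h : ((Set.range x)ᶜ : Set ℝ) = {w : ℝ | ∀ l, w ≠ x l} := by
    ext w; simp [eq_comm]
  rw [← h]
  exact (Set.finite_range x).countable.dense_compl ℝ

lemma drift_all {m : ℕ} (c : ℝ) (g x : Fin m → ℝ) (w : ℝ) (hx : Function.Injective x) :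
    ∑ i, ∑ j ∈ univ.erase i, (1 / (x i - x j)) * pdF c g x i w =
      -(1 / 2) * (FP c g x).derivative.derivative.eval w +
      1 / 2 * ∑ i, ∑ j ∈ univ.erase i, (g i - g j) / (x i - x j) *
        (PS x ((univ.erase i).erase j)).eval w := by
  have := Continuous.ext_on (dense_gen x)
    (f := fun w => ∑ i, ∑ j ∈ univ.erase i, (1 / (x i - x j)) * pdF c g x i w)
    (g := fun w => -(1 / 2) * (FP c g x).derivative.derivative.eval w +
      1 / 2 * ∑ i, ∑ j ∈ univ.erase i, (g i - g j) / (x i - x j) *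
        (PS x ((univ.erase i).erase j)).eval w)
    (by unfold pdF; fun_prop) (by fun_prop) (fun w hw => drift_gen c g x w hx hw)
  exact congrFun this w

lemma gamma_all {m : ℕ} (c : ℝ) (g x : Fin m → ℝ) (w v : ℝ) :
    (w - v) * (∑ i, pdF c g x i w * pdF c g x i v + ∑ i, ∑ j ∈ univ.erase i, g i * g j *
        ((PS x ((univ.erase i).erase j)).eval w * (PS x ((univ.erase i).erase j)).eval v)) =
      (FP c g x).eval w * (FP c g x).derivative.eval v -
        (FP c g x).derivative.eval w * (FP c g x).eval v := by
  have h1 : ∀ v, (∀ l, v ≠ x l) → ∀ w, 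
      (w - v) * (∑ i, pdF c g x i w * pdF c g x i v + ∑ i, ∑ j ∈ univ.erase i, g i * g j *
        ((PS x ((univ.erase i).erase j)).eval w * (PS x ((univ.erase i).erase j)).eval v)) =
      (FP c g x).eval w * (FP c g x).derivative.eval v -
        (FP c g x).derivative.eval w * (FP c g x).eval v := by
    intro v hv w
    have := Continuous.ext_on (dense_gen x)
      (f := fun w => (w - v) * (∑ i, pdF c g x i w * pdF c g x i v +
        ∑ i, ∑ j ∈ univ.erase i, g i * g j *
        ((PS x ((univ.erase i).erase j)).eval w * (PS x ((univ.erase i).erase j)).eval v)))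
      (g := fun w => (FP c g x).eval w * (FP c g x).derivative.eval v -
        (FP c g x).derivative.eval w * (FP c g x).eval v)
      (by unfold pdF; fun_prop) (by fun_prop) (fun w hw => gamma_gen c g x w v hw hv)
    exact congrFun this w
  have := Continuous.ext_on (dense_gen x)
      (f := fun v => (w - v) * (∑ i, pdF c g x i w * pdF c g x i v +
        ∑ i, ∑ j ∈ univ.erase i, g i * g j *
        ((PS x ((univ.erase i).erase j)).eval w * (PS x ((univ.erase i).erase j)).eval v)))
      (g := fun v => (FP c g x).eval w * (FP c g x).derivative.eval v -
        (FP c g x).derivative.eval w * (FP c g x).eval v)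
      (by unfold pdF; fun_prop) (by fun_prop) (fun v hv => h1 v hv w)
  exact congrFun this v

noncomputable def GB (θ : ℝ) (B : Finset ℝ) (q : Polynomial ℝ) : ℝ :=
  ∑ w ∈ B, (-(θ / 2) * q.derivative.derivative.eval w) * ∏ v ∈ B.erase w, q.eval v +
  1 / 2 * ∑ w ∈ B, ∑ v ∈ B.erase w,
    ((q.eval w * q.derivative.eval v - q.derivative.eval w * q.eval v) / (w - v)) *
      ∏ r ∈ (B.erase w).erase v, q.eval r

lemma genA_FPprod {m : ℕ} (θ c : ℝ) (g x : Fin m → ℝ) (B : Finset ℝ) (hx : Function.Injective x) :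
    genA θ (fun x => ∏ w ∈ B, (FP c g x).eval w) x = GB θ B (FP c g x) +
      θ / 2 * (∑ w ∈ B, (∑ i, ∑ j ∈ univ.erase i, (g i - g j) / (x i - x j) *
        (PS x ((univ.erase i).erase j)).eval w) * ∏ v ∈ B.erase w, (FP c g x).eval v) -
      1 / 2 * ∑ w ∈ B, ∑ v ∈ B.erase w, (∑ i, ∑ j ∈ univ.erase i, g i * g j *
        ((PS x ((univ.erase i).erase j)).eval w * (PS x ((univ.erase i).erase j)).eval v)) *
          ∏ r ∈ (B.erase w).erase v, (FP c g x).eval r := by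
  rw [genA_prod θ B (fun w x => (FP c g x).eval w) (fun w => FP_contDiff c g w)]
  have h1 : ∀ w, genA θ (fun x => (FP c g x).eval w) x =
      -(θ / 2) * (FP c g x).derivative.derivative.eval w + θ / 2 *
       ∑ i, ∑ j ∈ univ.erase i, (g i - g j) / (x i - x j) *
        (PS x ((univ.erase i).erase j)).eval w := by
    intro w
    unfold genA
    simp_rw [pd2_FP, pd_FP, drift_all c g x w hx]
    simp only [Finset.sum_const_zero]
    ring
  simp_rw [h1, pd_FP]
  have h2 : ∀ w ∈ B, ∀ v ∈ B.erase w, ∑ i, pdF c g x i w * pdF c g x i v =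
      ((FP c g x).eval w * (FP c g x).derivative.eval v -
        (FP c g x).derivative.eval w * (FP c g x).eval v) / (w - v) -
      ∑ i, ∑ j ∈ univ.erase i, g i * g j *
        ((PS x ((univ.erase i).erase j)).eval w * (PS x ((univ.erase i).erase j)).eval v) := by
    intro w _ v hv
    have hwv : w - v ≠ 0 := sub_ne_zero.2 (fun h => (Finset.mem_erase.1 hv).1 h.symm)
    rw [← gamma_all c g x w v, mul_div_cancel_left₀ _ hwv]
    ring
  rw [Finset.sum_congr rfl (fun w hw => Finset.sum_congr rfl (fun v hv => by rw [h2 w hw v hv]))]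
  unfold GB
  simp_rw [add_mul, sub_mul, Finset.sum_add_distrib, Finset.sum_sub_distrib]
  have h3 : ∀ (F H : ℝ → ℝ), ∑ w ∈ B, θ / 2 * F w * H w = θ / 2 * ∑ w ∈ B, F w * H w := by
    intro F H; rw [Finset.mul_sum]; exact Finset.sum_congr rfl fun _ _ => by ring
  rw [h3]
  ring

def Orth (m : ℕ) : Set (Fin m → ℝ) := Set.pi Set.univ (fun _ : Fin m => Set.Ioi (0:ℝ))

noncomputable def rho {m : ℕ} (θ : ℝ) (g : Fin m → ℝ) : ℝ :=
  ∏ j, (Real.exp (-(g j)) * (g j) ^ (θ - 1))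

lemma Orth_restrict (m : ℕ) : (volume : Measure (Fin m → ℝ)).restrict (Orth m) =
    Measure.pi (fun _ : Fin m => (volume : Measure ℝ).restrict (Set.Ioi 0)) := by
  rw [volume_pi, Orth, Measure.restrict_pi_pi]

lemma Orth_meas (m : ℕ) : MeasurableSet (Orth m) :=
  MeasurableSet.univ_pi fun _ => measurableSet_Ioi

lemma rho_mon {m : ℕ} (θ : ℝ) (n : Fin m →₀ ℕ) (g : Fin m → ℝ) (hg : g ∈ Orth m) :
    rho θ g * MvPolynomial.eval g (MvPolynomial.monomial n 1) =
      ∏ j, (Real.exp (-(g j)) * (g j) ^ (θ + n j - 1)) := by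
  rw [MvPolynomial.eval_monomial, one_mul, Finsupp.prod_fintype _ _ (by simp), rho,
    ← Finset.prod_mul_distrib]
  refine Finset.prod_congr rfl fun j _ => ?_
  have : 0 < g j := hg j (Set.mem_univ _)
  rw [mul_assoc, ← Real.rpow_natCast, ← Real.rpow_add this]
  congr 2; ring

lemma mon_int {m : ℕ} {θ : ℝ} (hθ : 0 < θ) (n : Fin m →₀ ℕ) :
    IntegrableOn (fun g => rho θ g * MvPolynomial.eval g (MvPolynomial.monomial n (1:ℝ))) (Orth m) := by
  rw [integrableOn_congr_fun (fun g hg => rho_mon θ n g hg) (Orth_meas m)]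
  rw [IntegrableOn, Orth_restrict]
  exact Integrable.fintype_prod (f := fun j (t:ℝ) => Real.exp (-t) * t ^ (θ + n j - 1))
    fun j => Real.GammaIntegral_convergent (s := θ + n j) (by positivity)

lemma mon_val {m : ℕ} {θ : ℝ} (hθ : 0 < θ) (n : Fin m →₀ ℕ) :
    ∫ g in Orth m, rho θ g * MvPolynomial.eval g (MvPolynomial.monomial n (1:ℝ)) =
      ∏ j, Real.Gamma (θ + n j) := by
  rw [setIntegral_congr_fun (Orth_meas m) (fun g hg => rho_mon θ n g hg)]
  rw [Orth_restrict]
  rw [integral_fintype_prod_eq_prod (f := fun j (t:ℝ) => Real.exp (-t) * t ^ (θ + n j - 1))]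
  refine Finset.prod_congr rfl fun j _ => ?_
  rw [Real.Gamma_eq_integral (by positivity)]

lemma EG_int {m : ℕ} {θ : ℝ} (hθ : 0 < θ) (P : MvPolynomial (Fin m) ℝ) :
    IntegrableOn (fun g => rho θ g * MvPolynomial.eval g P) (Orth m) := by
  induction P using MvPolynomial.induction_on' with
  | monomial n a =>
    have := (mon_int hθ n).const_mul a
    refine this.congr (Filter.Eventually.of_forall fun g => ?_)
    simp [MvPolynomial.eval_monomial]; ring
  | add p q hp hq =>
    refine (hp.add hq).congr (Filter.Eventually.of_forall fun g => ?_)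
    simp [mul_add]

noncomputable def EG {m : ℕ} {θ : ℝ} (hθ : 0 < θ) : MvPolynomial (Fin m) ℝ →ₗ[ℝ] ℝ where
  toFun P := ∫ g in Orth m, rho θ g * MvPolynomial.eval g P
  map_add' P Q := by
    rw [← integral_add (EG_int hθ P) (EG_int hθ Q)]
    simp [mul_add]
  map_smul' c P := by
    simp only [MvPolynomial.smul_eval, RingHom.id_apply, smul_eq_mul]
    rw [← integral_const_mul]
    congr 1; ext g; ring

lemma EG_apply {m : ℕ} {θ : ℝ} (hθ : 0 < θ) (P : MvPolynomial (Fin m) ℝ) :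
    EG hθ P = ∫ g in Orth m, rho θ g * MvPolynomial.eval g P := rfl

lemma EG_mon {m : ℕ} {θ : ℝ} (hθ : 0 < θ) (n : Fin m →₀ ℕ) (a : ℝ) :
    EG hθ (MvPolynomial.monomial n a) = a * ∏ j, Real.Gamma (θ + n j) := by
  rw [← mon_val hθ, ← EG_apply hθ, ← smul_eq_mul, ← map_smul, MvPolynomial.smul_monomial,
    smul_eq_mul, mul_one]

open MvPolynomial in
lemma IBP1 {m : ℕ} {θ : ℝ} (hθ : 0 < θ) (i : Fin m) (P : MvPolynomial (Fin m) ℝ) :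
    EG hθ (X i * P) = θ * EG hθ P + EG hθ (X i * pderiv i P) := by
  induction P using MvPolynomial.induction_on' with
  | monomial n a =>
    rw [X_mul_pderiv_monomial, map_nsmul, X, monomial_mul, EG_mon, EG_mon, one_mul, nsmul_eq_mul,
      ← add_mul]
    rw [← Finset.mul_prod_erase univ _ (mem_univ i), ← Finset.mul_prod_erase univ (fun j => Real.Gamma (θ + n j)) (mem_univ i)]
    have h1 : ∀ j ∈ univ.erase i, Real.Gamma (θ + ((Finsupp.single i 1 + n : Fin m →₀ ℕ) j : ℕ)) =
        Real.Gamma (θ + n j) := by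
      intro j hj
      simp [Finsupp.single_apply, (Finset.ne_of_mem_erase hj).symm]
    rw [Finset.prod_congr rfl h1]
    have : Real.Gamma (θ + ((Finsupp.single i 1 + n : Fin m →₀ ℕ) i : ℕ)) = (θ + n i) * Real.Gamma (θ + n i) := by
      rw [← Real.Gamma_add_one (by positivity)]
      congr 1; simp; ring
    rw [this]; ring
  | add p q hp hq =>
    simp only [mul_add, map_add, hp, hq]; ring

open MvPolynomial in
lemma IBP2 {m : ℕ} {θ : ℝ} (hθ : 0 < θ) {i l : Fin m} (hil : i ≠ l) (H : MvPolynomial (Fin m) ℝ) :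
    θ * EG hθ ((X i - X l) * H) = EG hθ (X i * X l * (pderiv i H - pderiv l H)) := by
  have h1 := IBP1 hθ i (X l * H)
  have h2 := IBP1 hθ l (X i * H)
  rw [Derivation.leibniz, pderiv_X_of_ne hil.symm] at h1
  rw [Derivation.leibniz, pderiv_X_of_ne hil] at h2
  simp only [mul_zero, add_zero, smul_eq_mul] at h1 h2
  rw [show X l * (X i * H) = X i * (X l * H) by ring] at h2
  rw [show X i * X l * (pderiv i H - pderiv l H) = X i * (X l * pderiv i H) - X l * (X i * pderiv l H) by ring,
    sub_mul, map_sub, map_sub]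
  linarith

noncomputable def FM {m : ℕ} (x : Fin m → ℝ) (w : ℝ) : MvPolynomial (Fin m) ℝ :=
  ∑ j, MvPolynomial.C ((PS x (univ.erase j)).eval w) * MvPolynomial.X j

lemma FM_eval {m : ℕ} (x g : Fin m → ℝ) (w : ℝ) :
    MvPolynomial.eval g (FM x w) = (FP 0 g x).eval w := by
  rw [FP_eval, FM]; simp [mul_comm]

lemma pderiv_FM {m : ℕ} (x : Fin m → ℝ) (w : ℝ) (i : Fin m) :
    MvPolynomial.pderiv i (FM x w) = MvPolynomial.C ((PS x (univ.erase i)).eval w) := by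
  classical
  rw [FM, map_sum]
  simp [MvPolynomial.pderiv_X, Pi.single_apply]

lemma pderiv_prod' {m : ℕ} (i : Fin m) (B : Finset ℝ) (f : ℝ → MvPolynomial (Fin m) ℝ) :
    MvPolynomial.pderiv i (∏ w ∈ B, f w) =
      ∑ w ∈ B, MvPolynomial.pderiv i (f w) * ∏ v ∈ B.erase w, f v := by
  classical
  induction B using Finset.induction_on with
  | empty => simp
  | insert a s ha ih =>
    rw [Finset.prod_insert ha, Derivation.leibniz, ih, Finset.sum_insert ha, Finset.erase_insert ha,
      smul_eq_mul, smul_eq_mul, Finset.mul_sum, add_comm, mul_comm]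
    congr 1
    refine Finset.sum_congr rfl fun w hw => ?_
    have : w ≠ a := by rintro rfl; exact ha hw
    rw [Finset.erase_insert_of_ne this.symm, Finset.prod_insert (by simp [ha])]
    ring

lemma PS_diff {m : ℕ} (x : Fin m → ℝ) {i j : Fin m} (h : j ≠ i) (w : ℝ) :
    (PS x (univ.erase i)).eval w - (PS x (univ.erase j)).eval w =
      (x i - x j) * (PS x ((univ.erase i).erase j)).eval w := by
  have h1 : (PS x (univ.erase i)).eval w = (w - x j) * (PS x ((univ.erase i).erase j)).eval w := by
    rw [PS_eval, PS_eval, ← Finset.mul_prod_erase _ _ (Finset.mem_erase.2 ⟨h, mem_univ j⟩)]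
  have h2 : (PS x (univ.erase j)).eval w = (w - x i) * (PS x ((univ.erase i).erase j)).eval w := by
    rw [PS_eval, PS_eval, ← Finset.mul_prod_erase _ _ (Finset.mem_erase.2 ⟨h.symm, mem_univ i⟩),
      Finset.erase_right_comm]
  rw [h1, h2]; ring

/-- correction polynomial -/
noncomputable def CorP {m : ℕ} (θ : ℝ) (x : Fin m → ℝ) (B : Finset ℝ) : MvPolynomial (Fin m) ℝ :=
  ∑ w ∈ B, ∑ i, ∑ j ∈ univ.erase i,
    (((θ/2) * ((x i - x j)⁻¹ * (PS x ((univ.erase i).erase j)).eval w)) •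
      ((MvPolynomial.X i - MvPolynomial.X j) * ∏ v ∈ B.erase w, FM x v)
     - (1/2 : ℝ) • ∑ v ∈ B.erase w, ((PS x ((univ.erase i).erase j)).eval w *
        (PS x ((univ.erase i).erase j)).eval v) • (MvPolynomial.X i * MvPolynomial.X j *
          ∏ r ∈ (B.erase w).erase v, FM x r))

lemma CorP_eval {m : ℕ} (θ : ℝ) (x g : Fin m → ℝ) (B : Finset ℝ) :
    MvPolynomial.eval g (CorP θ x B) = θ/2 * (∑ w ∈ B, (∑ i, ∑ j ∈ univ.erase i, (g i - g j)/(x i - x j) * (PS x ((univ.erase i).erase j)).eval w) * ∏ v ∈ B.erase w, (FP 0 g x).eval v) - 1/2 * ∑ w ∈ B, ∑ v ∈ B.erase w, (∑ i, ∑ j ∈ univ.erase i, g i * g j * ((PS x ((univ.erase i).erase j)).eval w * (PS x ((univ.erase i).erase j)).eval v)) * ∏ r ∈ (B.erase w).erase v, (FP 0 g x).eval r := by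
  simp only [CorP, map_sum, map_sub, map_mul, map_prod, FM_eval, MvPolynomial.smul_eval, MvPolynomial.eval_X]
  rw [Finset.mul_sum, Finset.mul_sum, ← Finset.sum_sub_distrib]
  refine Finset.sum_congr rfl fun w _ => ?_
  simp_rw [Finset.sum_sub_distrib]
  congr 1
  · simp_rw [Finset.sum_mul, Finset.mul_sum]
    refine Finset.sum_congr rfl fun i _ => Finset.sum_congr rfl fun j _ => ?_
    rw [div_eq_mul_inv]; ring
  · simp_rw [Finset.sum_mul, Finset.mul_sum]
    symm
    rw [Finset.sum_comm]
    refine Finset.sum_congr rfl fun i _ => ?_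
    rw [Finset.sum_comm]
    refine Finset.sum_congr rfl fun j _ => Finset.sum_congr rfl fun v _ => ?_
    ring

lemma EG_CorP {m : ℕ} {θ : ℝ} (hθ : 0 < θ) (x : Fin m → ℝ) (hx : Function.Injective x) (B : Finset ℝ) :
    EG hθ (CorP θ x B) = 0 := by
  rw [CorP, map_sum]
  refine Finset.sum_eq_zero fun w _ => ?_
  rw [map_sum]
  refine Finset.sum_eq_zero fun i _ => ?_
  rw [map_sum]
  refine Finset.sum_eq_zero fun j hj => ?_
  have hji := Finset.ne_of_mem_erase hj
  rw [map_sub, map_smul, smul_eq_mul]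
  have h := IBP2 hθ hji.symm (∏ v ∈ B.erase w, FM x v)
  rw [pderiv_prod', pderiv_prod', ← Finset.sum_sub_distrib] at h
  have h2 : ∀ v ∈ B.erase w, (MvPolynomial.pderiv i (FM x v) * ∏ r ∈ (B.erase w).erase v, FM x r -
      MvPolynomial.pderiv j (FM x v) * ∏ r ∈ (B.erase w).erase v, FM x r) =
      ((x i - x j) * (PS x ((univ.erase i).erase j)).eval v) • ∏ r ∈ (B.erase w).erase v, FM x r := by
    intro v _
    rw [← sub_mul, pderiv_FM, pderiv_FM, ← map_sub, PS_diff x hji, MvPolynomial.smul_eq_C_mul]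
  rw [Finset.sum_congr rfl h2] at h
  have hne : x i - x j ≠ 0 := sub_ne_zero.2 fun e => hji (hx e).symm
  rw [show (θ/2) * ((x i - x j)⁻¹ * (PS x ((univ.erase i).erase j)).eval w) *
    EG hθ ((MvPolynomial.X i - MvPolynomial.X j) * ∏ v ∈ B.erase w, FM x v) =
     (1/2) * ((x i - x j)⁻¹ * (PS x ((univ.erase i).erase j)).eval w) * (θ *
    EG hθ ((MvPolynomial.X i - MvPolynomial.X j) * ∏ v ∈ B.erase w, FM x v)) by ring, h]
  simp only [Finset.mul_sum, map_sum, map_smul, mul_smul_comm, smul_eq_mul]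
  rw [← Finset.sum_sub_distrib]
  refine Finset.sum_eq_zero fun v _ => ?_
  field_simp
  ring

noncomputable def Qs {m : ℕ} (B : Finset ℝ) (σ : B → Fin m) (x : Fin m → ℝ) : ℝ :=
  ∏ w : B, (PS x (univ.erase (σ w))).eval (w:ℝ)

noncomputable def Ms {m : ℕ} (B : Finset ℝ) (σ : B → Fin m) : MvPolynomial (Fin m) ℝ :=
  ∏ w : B, MvPolynomial.X (σ w)

lemma FPprod_expand {m : ℕ} (B : Finset ℝ) (g x : Fin m → ℝ) :
    ∏ w ∈ B, (FP 0 g x).eval w = ∑ σ : B → Fin m, MvPolynomial.eval g (Ms B σ) * Qs B σ x := by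
  rw [← Finset.prod_coe_sort]
  simp_rw [FP_eval, zero_mul, zero_add, Fintype.prod_sum]
  refine Finset.sum_congr rfl fun σ _ => ?_
  simp [Ms, Qs, map_prod, Finset.prod_mul_distrib]

lemma Qs_contDiff {m : ℕ} (B : Finset ℝ) (σ : B → Fin m) : ContDiff ℝ 2 (Qs B σ) := by
  unfold Qs
  exact contDiff_prod fun w _ => PS_contDiff _ _

noncomputable def fpoly {m : ℕ} {θ : ℝ} (hθ : 0 < θ) (B : Finset ℝ) : MvPolynomial (Fin m) ℝ :=
  ∑ σ : B → Fin m, MvPolynomial.C (EG hθ (Ms B σ)) *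
    ∏ w : B, ∏ l ∈ univ.erase (σ w), (MvPolynomial.C (w:ℝ) - MvPolynomial.X l)

lemma fpoly_eval {m : ℕ} {θ : ℝ} (hθ : 0 < θ) (B : Finset ℝ) (x : Fin m → ℝ) :
    MvPolynomial.eval x (fpoly hθ B) = ∑ σ : B → Fin m, EG hθ (Ms B σ) * Qs B σ x := by
  simp [fpoly, Qs, PS_eval, map_prod]

lemma fpoly_int {m : ℕ} {θ : ℝ} (hθ : 0 < θ) (B : Finset ℝ) (x : Fin m → ℝ) :
    MvPolynomial.eval x (fpoly hθ B) = ∫ g in Orth m, rho θ g * ∏ w ∈ B, (FP 0 g x).eval w := by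
  have : ∀ g : Fin m → ℝ, ∏ w ∈ B, (FP 0 g x).eval w =
      MvPolynomial.eval g (∑ σ : B → Fin m, Qs B σ x • Ms B σ) := by
    intro g
    rw [FPprod_expand]; simp [MvPolynomial.smul_eval, mul_comm]
  simp_rw [this]
  rw [← EG_apply hθ, fpoly_eval]
  simp [mul_comm]

lemma fpoly_genA {m : ℕ} {θ : ℝ} (hθ : 0 < θ) (B : Finset ℝ) (x : Fin m → ℝ)
    (hx : Function.Injective x) :
    genA θ (fun x => MvPolynomial.eval x (fpoly hθ B)) x =
      ∫ g in Orth m, rho θ g * GB θ B (FP 0 g x) := by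
  have key : ∀ g : Fin m → ℝ, GB θ B (FP 0 g x) = MvPolynomial.eval g
      ((∑ σ : B → Fin m, genA θ (Qs B σ) x • Ms B σ) - CorP θ x B) := by
    intro g
    have h1 := genA_FPprod θ 0 g x B hx
    rw [show (fun x : Fin m → ℝ => ∏ w ∈ B, (FP 0 g x).eval w) = _ from
      funext fun x => FPprod_expand B g x] at h1
    rw [genA_sum θ univ _ _ (fun σ _ => Qs_contDiff B σ)] at h1
    rw [map_sub, CorP_eval]
    simp only [map_sum, MvPolynomial.smul_eval]
    simp_rw [mul_comm (genA _ _ _)]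
    rw [h1]; ring
  simp_rw [key]
  rw [← EG_apply hθ, map_sub, EG_CorP hθ x hx, sub_zero]
  simp_rw [fpoly_eval]
  rw [genA_sum θ univ _ _ (fun σ _ => Qs_contDiff B σ)]
  simp [mul_comm]

noncomputable def VD {n : ℕ} (y : Fin n → ℝ) : ℝ := ∏ i : Fin n, ∏ j ∈ Ioi i, (y j - y i)

lemma VD_det {n : ℕ} (y : Fin n → ℝ) : (Matrix.vandermonde y).det = VD y :=
  Matrix.det_vandermonde y

lemma VD_pos {n : ℕ} {y : Fin n → ℝ} (hy : StrictMono y) : 0 < VD y :=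
  Finset.prod_pos fun i _ => Finset.prod_pos fun j hj => sub_pos.2 (hy (Finset.mem_Ioi.1 hj))

lemma offdiag_abs {n : ℕ} (y : Fin n → ℝ) :
    |∏ i, ∏ j ∈ univ.erase i, (y i - y j)| = VD y ^ 2 := by
  have h1 : ∀ i : Fin n, ∏ j ∈ univ.erase i, (y i - y j) =
      (∏ j ∈ Ioi i, (y i - y j)) * ∏ j ∈ Iio i, (y i - y j) := by
    intro i
    rw [← Finset.prod_union]
    · congr 1
      ext j; simp only [mem_erase, mem_univ, and_true, mem_union, mem_Ioi, mem_Iio]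
      exact ⟨fun h => (lt_or_gt_of_ne h).symm, fun h => h.elim ne_of_gt ne_of_lt⟩
    · rw [Finset.disjoint_left]; intro j h1 h2
      rw [mem_Ioi] at h1; rw [mem_Iio] at h2; exact absurd h1 h2.not_gt
  simp_rw [h1]
  rw [Finset.prod_mul_distrib]
  have h2 : ∏ i : Fin n, ∏ j ∈ Iio i, (y i - y j) = VD y := by
    rw [VD, Finset.prod_comm' (t' := univ) (s' := fun j => Ioi j) (by simp)]
  have h3 : |∏ i : Fin n, ∏ j ∈ Ioi i, (y i - y j)| = |VD y| := by
    rw [VD]; simp_rw [Finset.abs_prod]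
    refine Finset.prod_congr rfl fun i _ => Finset.prod_congr rfl fun j _ => abs_sub_comm _ _
  rw [abs_mul, h3, h2, ← abs_mul, ← sq, abs_of_nonneg (sq_nonneg _)]

lemma det_polys {n : ℕ} (v : Fin n → ℝ) (p : Fin n → Polynomial ℝ) (h : ∀ i, (p i).natDegree < n) :
    Matrix.det (Matrix.of fun i j => (p j).eval (v i)) =
      VD v * Matrix.det (Matrix.of fun i j : Fin n => (p j).coeff i) := by
  rw [← VD_det, ← Matrix.det_mul]
  congr 1
  ext i j
  rw [Matrix.mul_apply, Matrix.of_apply, Polynomial.eval_eq_sum_range' (h j), ← Fin.sum_univ_eq_sum_range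
    (fun a => (p j).coeff a * v i ^ a)]
  refine Finset.sum_congr rfl fun a _ => ?_
  simp [Matrix.vandermonde_apply, mul_comm]

lemma PS_monic {m : ℕ} (x : Fin m → ℝ) (s : Finset (Fin m)) : (PS x s).Monic :=
  Polynomial.monic_prod_of_monic _ _ fun _ _ => Polynomial.monic_X_sub_C _

lemma PS_natDegree {m : ℕ} (x : Fin m → ℝ) (s : Finset (Fin m)) : (PS x s).natDegree = s.card := by
  rw [PS, Polynomial.natDegree_prod_of_monic _ _ fun _ _ => Polynomial.monic_X_sub_C _]
  simp

/-- columns of the derivative -/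
noncomputable def colP {k : ℕ} (s : ℝ) (y : Fin k → ℝ) : Fin (k+1) → Polynomial ℝ :=
  Fin.snoc (fun i => Polynomial.C (-s) * PS y (univ.erase i)) (PS y univ)

lemma colP_deg {k : ℕ} (s : ℝ) (y : Fin k → ℝ) (i : Fin (k+1)) : (colP s y i).natDegree < k + 1 := by
  induction i using Fin.lastCases with
  | last => simp [colP, PS_natDegree]
  | cast i =>
    simp only [colP, Fin.snoc_castSucc]
    refine lt_of_le_of_lt (Polynomial.natDegree_C_mul_le _ _) ?_
    rw [PS_natDegree]
    exact lt_of_le_of_lt (Finset.card_le_univ _) (by simp)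

lemma VD_snoc {k : ℕ} (y : Fin k → ℝ) (ξ : ℝ) :
    VD (Fin.snoc y ξ : Fin (k+1) → ℝ) = VD y * ∏ i, (ξ - y i) := by
  rw [VD, Fin.prod_univ_castSucc]
  have : ∀ i : Fin k, Ioi (i.castSucc) = insert (Fin.last k) ((Ioi i).map Fin.castSuccEmb) := by
    intro i; ext j
    induction j using Fin.lastCases with
    | last => simp [Fin.castSucc_lt_last]
    | cast j => simp [Fin.le_last]
  have h0 : Ioi (Fin.last k) = ∅ := by
    ext j; simp [Fin.le_last]
  rw [h0, prod_empty, mul_one]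
  have h2 : ∀ i : Fin k, ∏ j ∈ Ioi i.castSucc, ((Fin.snoc y ξ : Fin (k+1) → ℝ) j - (Fin.snoc y ξ : Fin (k+1) → ℝ) i.castSucc) =
      (ξ - y i) * ∏ j ∈ Ioi i, (y j - y i) := by
    intro i
    rw [this, prod_insert (by simp [Fin.castSucc_ne_last]), prod_map]
    simp
  simp_rw [h2]
  rw [prod_mul_distrib, VD, mul_comm]

lemma det_colP_coeff {k : ℕ} {s : ℝ} (hs : 0 < s) (y : Fin k → ℝ) (hy : StrictMono y) :
    |Matrix.det (Matrix.of fun i j : Fin (k+1) => (colP s y j).coeff i)| = s ^ k * VD y := by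
  obtain ⟨ξ, hξ⟩ : ∃ ξ, ∀ i, y i < ξ := by
    obtain ⟨M, hM⟩ := (Set.finite_range y).bddAbove
    exact ⟨M+1, fun i => by have := hM ⟨i, rfl⟩; linarith⟩
  have h1 := det_polys (Fin.snoc y ξ : Fin (k+1) → ℝ) (colP s y) (colP_deg s y)
  have hpr : 0 < ∏ i, (ξ - y i) := Finset.prod_pos fun i _ => sub_pos.2 (hξ i)
  rw [Matrix.det_of_isLowerTriangular, VD_snoc, Fin.prod_univ_castSucc] at h1
  · simp only [Matrix.of_apply, Fin.snoc_castSucc, Fin.snoc_last, colP, PS_eval,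
      Polynomial.eval_mul, Polynomial.eval_C] at h1
    rw [prod_mul_distrib] at h1
    apply_fun abs at h1
    rw [abs_mul, abs_mul, abs_mul, abs_mul, offdiag_abs, prod_const, card_univ, Fintype.card_fin,
      abs_pow, abs_neg, abs_of_pos hs, abs_of_pos hpr, abs_of_pos (VD_pos hy)] at h1
    have := VD_pos hy
    refine mul_left_cancel₀ (mul_pos this hpr).ne' ?_
    unfold colP
    rw [← h1]; ring
  · intro i j hij
    rw [OrderDual.toDual_lt_toDual] at hij
    simp only [Matrix.of_apply]
    have hi : i ≠ Fin.last k := (lt_of_lt_of_le hij (Fin.le_last j)).ne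
    obtain ⟨i, rfl⟩ := Fin.exists_castSucc_eq.2 hi
    rw [Fin.snoc_castSucc]
    induction j using Fin.lastCases with
    | last =>
      simp only [colP, Fin.snoc_last, PS_eval]
      exact Finset.prod_eq_zero (mem_univ i) (sub_self _)
    | cast j =>
      simp only [colP, Fin.snoc_castSucc, PS_eval, Polynomial.eval_mul]
      rw [Finset.prod_eq_zero (i := i) _ (sub_self _), mul_zero]
      simp only [mem_erase, mem_univ, and_true]
      rintro rfl; exact lt_irrefl _ hij

noncomputable def den {k : ℕ} (x : Fin (k+1) → ℝ) (j : Fin (k+1)) : ℝ :=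
  (PS x (univ.erase j)).eval (x j)

lemma den_abs {k : ℕ} (x : Fin (k+1) → ℝ) : |∏ j, den x j| = VD x ^ 2 := by
  rw [← offdiag_abs]; simp [den, PS_eval]

lemma den_ne {k : ℕ} {x : Fin (k+1) → ℝ} (hx : Function.Injective x) (j : Fin (k+1)) : den x j ≠ 0 := by
  rw [den, PS_eval]
  exact Finset.prod_ne_zero_iff.2 fun l hl => sub_ne_zero.2 fun h => (Finset.ne_of_mem_erase hl) (hx h).symm

noncomputable def Phi {k : ℕ} (x : Fin (k+1) → ℝ) (z : Fin (k+1) → ℝ) (j : Fin (k+1)) : ℝ :=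
  z (Fin.last k) * (PS (fun i : Fin k => z i.castSucc) univ).eval (x j) * (den x j)⁻¹

noncomputable def JM {k : ℕ} (x : Fin (k+1) → ℝ) (z : Fin (k+1) → ℝ) : Matrix (Fin (k+1)) (Fin (k+1)) ℝ :=
  Matrix.of fun j i => (den x j)⁻¹ * (colP (z (Fin.last k)) (fun i : Fin k => z i.castSucc) i).eval (x j)

lemma JM_det {k : ℕ} {x : Fin (k+1) → ℝ} (hx : StrictMono x) (z : Fin (k+1) → ℝ)
    (hz : 0 < z (Fin.last k)) (hy : StrictMono (fun i : Fin k => z i.castSucc)) :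
    |(JM x z).det| = z (Fin.last k) ^ k * VD (fun i : Fin k => z i.castSucc) * (VD x)⁻¹ := by
  have : JM x z = Matrix.of fun j i => (den x j)⁻¹ * (Matrix.of fun j i => (colP (z (Fin.last k)) (fun i : Fin k => z i.castSucc) i).eval (x j)) j i := rfl
  rw [this, Matrix.det_mul_column, det_polys _ _ (colP_deg _ _), abs_mul, abs_mul, det_colP_coeff hz _ hy,
    Finset.prod_inv_distrib, abs_inv, den_abs, abs_of_pos (VD_pos hx)]
  have := VD_pos hx
  field_simp

lemma Phi_hasFDerivAt {k : ℕ} (x : Fin (k+1) → ℝ) (z : Fin (k+1) → ℝ) :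
    HasFDerivAt (Phi x) (LinearMap.toContinuousLinearMap (Matrix.toLin' (JM x z))) z := by
  rw [hasFDerivAt_pi']
  intro j
  have h1 : ∀ i : Fin k, HasFDerivAt (fun z : Fin (k+1) → ℝ => x j - z i.castSucc)
      (-(ContinuousLinearMap.proj (R := ℝ) (φ := fun _ : Fin (k+1) => ℝ) i.castSucc)) z :=
    fun i => (hasFDerivAt_apply (𝕜 := ℝ) i.castSucc z).const_sub (x j)
  have h2 := HasFDerivAt.finsetProd (u := univ) (fun i _ => h1 i)
  have h3 := (((hasFDerivAt_apply (𝕜 := ℝ) (Fin.last k) z).mul h2).mul_const (den x j)⁻¹)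
  have h4 : (fun z => Phi x z j) = fun z : Fin (k+1) → ℝ => z (Fin.last k) * (∏ i : Fin k, (x j - z i.castSucc)) * (den x j)⁻¹ := by
    ext z; simp [Phi, PS_eval]
  rw [h4]
  refine HasFDerivAt.congr_fderiv h3 ?_
  ext v
  simp [Matrix.mulVec, dotProduct, Fin.sum_univ_castSucc, JM, colP, PS_eval]
  rw [Finset.mul_sum, Finset.mul_sum]
  congr 1
  · congr 1
    exact Finset.sum_congr rfl fun i _ => by ring
  · ring

def Dz {k : ℕ} (x : Fin (k+1) → ℝ) : Set (Fin (k+1) → ℝ) :=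
  {z | 0 < z (Fin.last k) ∧ ∀ i : Fin k, x i.castSucc < z i.castSucc ∧ z i.castSucc < x i.succ}

lemma interl_strictMono {k : ℕ} {x : Fin (k+1) → ℝ} (hx : StrictMono x) {y : Fin k → ℝ}
    (hy : ∀ i : Fin k, x i.castSucc < y i ∧ y i < x i.succ) : StrictMono y := by
  intro i j hij
  refine ((hy i).2.trans_le (hx.monotone ?_)).trans (hy j).1
  rw [Fin.le_def]; simp; exact hij

lemma FP_nodes {k : ℕ} (x g : Fin (k+1) → ℝ) (j : Fin (k+1)) :
    (FP 0 g x).eval (x j) = g j * den x j := by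
  rw [FP_eval, zero_mul, zero_add, Finset.sum_eq_single j]
  · rfl
  · intro l _ hl
    rw [PS_eval, Finset.prod_eq_zero (i := j) (by simp [hl.symm]) (sub_self _), mul_zero]
  · simp

lemma FP_degree {k : ℕ} (x g : Fin (k+1) → ℝ) : (FP 0 g x).degree < (k+1 : ℕ) := by
  rw [FP, Polynomial.C_0, zero_mul, zero_add]
  rw [← Polynomial.mem_degreeLT]
  refine Submodule.sum_mem _ fun j _ => ?_
  rw [← Polynomial.smul_eq_C_mul]
  refine Submodule.smul_mem _ _ ?_
  rw [Polynomial.mem_degreeLT]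
  refine lt_of_le_of_lt Polynomial.degree_le_natDegree ?_
  rw [PS_natDegree]
  simp
  exact_mod_cast Nat.lt_succ_self k

lemma FP_coeff {k : ℕ} (x g : Fin (k+1) → ℝ) : (FP 0 g x).coeff k = ∑ j, g j := by
  rw [FP, Polynomial.C_0, zero_mul, zero_add, Polynomial.finsetSum_coeff]
  refine Finset.sum_congr rfl fun j _ => ?_
  have := (PS_monic x (univ.erase j)).coeff_natDegree
  rw [PS_natDegree] at this
  simp at this
  simp [this]

lemma SP_coeff {k : ℕ} (s : ℝ) (y : Fin k → ℝ) : (Polynomial.C s * PS y univ).coeff k = s := by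
  have := (PS_monic y univ).coeff_natDegree
  rw [PS_natDegree] at this
  simp at this
  simp [this]

lemma SP_degree {k : ℕ} (s : ℝ) (y : Fin k → ℝ) : (Polynomial.C s * PS y univ).degree < (k+1 : ℕ) := by
  rw [← Polynomial.mem_degreeLT, ← Polynomial.smul_eq_C_mul]
  refine Submodule.smul_mem _ _ ?_
  rw [Polynomial.mem_degreeLT]
  refine lt_of_le_of_lt Polynomial.degree_le_natDegree ?_
  rw [PS_natDegree]
  simp
  exact_mod_cast Nat.lt_succ_self k

lemma FP_Phi {k : ℕ} {x : Fin (k+1) → ℝ} (hx : Function.Injective x) (z : Fin (k+1) → ℝ) :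
    FP 0 (Phi x z) x = Polynomial.C (z (Fin.last k)) * PS (fun i : Fin k => z i.castSucc) univ := by
  refine Polynomial.eq_of_degrees_lt_of_eval_index_eq univ (v := x) hx.injOn ?_ ?_ ?_
  · simpa using FP_degree x _
  · simpa using SP_degree _ _
  · intro j _
    rw [FP_nodes, Phi, Polynomial.eval_mul, Polynomial.eval_C]
    have := den_ne hx j
    field_simp

lemma Phi_sum {k : ℕ} {x : Fin (k+1) → ℝ} (hx : Function.Injective x) (z : Fin (k+1) → ℝ) :
    ∑ j, Phi x z j = z (Fin.last k) := by
  rw [← FP_coeff x, FP_Phi hx, SP_coeff]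

lemma den_succAbove {k : ℕ} (x : Fin (k+1) → ℝ) (j : Fin (k+1)) :
    den x j = ∏ i : Fin k, (x j - x (j.succAbove i)) := by
  rw [den, PS_eval]
  have : univ.erase j = univ.map (Fin.succAboveEmb j) := by
    ext l; simp [Fin.exists_succAbove_eq_iff]
  rw [this, prod_map]; rfl

lemma Phi_pos {k : ℕ} {x : Fin (k+1) → ℝ} (hx : StrictMono x) {z : Fin (k+1) → ℝ} (hz : z ∈ Dz x)
    (j : Fin (k+1)) : 0 < Phi x z j := by
  rw [Phi, mul_assoc]
  refine mul_pos hz.1 ?_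
  rw [PS_eval, den_succAbove, ← div_eq_mul_inv, ← Finset.prod_div_distrib]
  refine Finset.prod_pos fun i _ => ?_
  rcases lt_or_ge i.castSucc j with h | h
  · rw [Fin.succAbove_of_castSucc_lt _ _ h]
    have h1 := hx h
    have h2 : x i.succ ≤ x j := hx.monotone (Fin.castSucc_lt_iff_succ_le.1 h)
    exact div_pos (by linarith [(hz.2 i).2]) (by linarith)
  · rw [Fin.succAbove_of_le_castSucc _ _ h]
    have h1 : x j ≤ x i.castSucc := hx.monotone h
    have h2 := hx (Fin.castSucc_lt_succ (i := i))
    exact div_pos_of_neg_of_neg (by linarith [(hz.2 i).1]) (by linarith)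

lemma Phi_injOn {k : ℕ} {x : Fin (k+1) → ℝ} (hx : StrictMono x) : Set.InjOn (Phi x) (Dz x) := by
  intro z hz z' hz' h
  have hs : z (Fin.last k) = z' (Fin.last k) := by
    rw [← Phi_sum hx.injective z, h, Phi_sum hx.injective z']
  have hp := FP_Phi hx.injective z
  rw [h, FP_Phi hx.injective z', hs] at hp
  ext j
  induction j using Fin.lastCases with
  | last => exact hs
  | cast i =>
    have h1 : (PS (fun i : Fin k => z' i.castSucc) univ).eval (z i.castSucc) = 0 := by
      have := congrArg (Polynomial.eval (z i.castSucc)) hp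
      rw [Polynomial.eval_mul, Polynomial.eval_mul, Polynomial.eval_C, PS_eval (fun i : Fin k => z i.castSucc),
        Finset.prod_eq_zero (mem_univ i) (sub_self _), mul_zero] at this
      exact (mul_eq_zero.1 this).resolve_left hz'.1.ne'
    rw [PS_eval, Finset.prod_eq_zero_iff] at h1
    obtain ⟨a, _, ha⟩ := h1
    have ha := sub_eq_zero.1 ha
    rcases lt_trichotomy i a with h | h | h
    · have : x i.succ ≤ x a.castSucc := hx.monotone (by rw [Fin.le_def]; simp; exact h)
      linarith [(hz.2 i).2, (hz'.2 a).1]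
    · rw [ha, h]
    · have : x a.succ ≤ x i.castSucc := hx.monotone (by rw [Fin.le_def]; simp; exact h)
      linarith [(hz.2 i).1, (hz'.2 a).2]

lemma den_neg {k : ℕ} {x : Fin (k+1) → ℝ} (hx : StrictMono x) (i : Fin k) :
    den x i.castSucc * den x i.succ < 0 := by
  have hlt : i.castSucc < i.succ := Fin.castSucc_lt_succ
  rw [den, den, PS_eval, PS_eval,
    ← Finset.mul_prod_erase (univ.erase i.castSucc) _ (a := i.succ) (by simp [hlt.ne']),
    ← Finset.mul_prod_erase (univ.erase i.succ) _ (a := i.castSucc) (by simp [hlt.ne]),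
    Finset.erase_right_comm (a := i.succ)]
  have hd := hx hlt
  have hp : 0 < (∏ l ∈ (univ.erase i.castSucc).erase i.succ, (x i.castSucc - x l)) *
      ∏ l ∈ (univ.erase i.castSucc).erase i.succ, (x i.succ - x l) := by
    rw [← Finset.prod_mul_distrib]
    refine Finset.prod_pos fun l hl => ?_
    simp only [mem_erase, mem_univ, and_true] at hl
    rcases lt_or_ge l i.castSucc with h | h
    · have := hx h
      exact mul_pos (by linarith) (by linarith)
    · have : i.succ < l := by
        have h1 := lt_of_le_of_ne h (Ne.symm hl.2)
        exact lt_of_le_of_ne (Fin.castSucc_lt_iff_succ_le.1 h1) (Ne.symm hl.1)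
      have := hx this
      exact mul_pos_of_neg_of_neg (by linarith) (by linarith)
  nlinarith [mul_pos hp (mul_pos (sub_pos.2 hd) (sub_pos.2 hd))]

lemma Phi_image {k : ℕ} {x : Fin (k+1) → ℝ} (hx : StrictMono x) : Phi x '' Dz x = Orth (k+1) := by
  apply Set.Subset.antisymm
  · rintro _ ⟨z, hz, rfl⟩ j _
    exact Phi_pos hx hz j
  · intro g hg
    have hg : ∀ j, 0 < g j := fun j => hg j (Set.mem_univ _)
    have hroot : ∀ i : Fin k, ∃ r, (x i.castSucc < r ∧ r < x i.succ) ∧ (FP 0 g x).eval r = 0 := by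
      intro i
      have hlt := hx (Fin.castSucc_lt_succ (i := i))
      have hneg : (FP 0 g x).eval (x i.castSucc) * (FP 0 g x).eval (x i.succ) < 0 := by
        rw [FP_nodes, FP_nodes]
        have := mul_neg_of_pos_of_neg (mul_pos (hg i.castSucc) (hg i.succ)) (den_neg hx i)
        linarith
      have hc : ContinuousOn (fun t => (FP 0 g x).eval t) (Set.Icc (x i.castSucc) (x i.succ)) :=
        (FP 0 g x).continuous.continuousOn
      rcases mul_neg_iff.1 hneg with ⟨h1, h2⟩ | ⟨h1, h2⟩
      · obtain ⟨r, hr, h0⟩ := intermediate_value_Ioo' hlt.le hc ⟨h2, h1⟩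
        exact ⟨r, hr, h0⟩
      · obtain ⟨r, hr, h0⟩ := intermediate_value_Ioo hlt.le hc ⟨h1, h2⟩
        exact ⟨r, hr, h0⟩
    choose y hy hy0 using hroot
    have hym := interl_strictMono hx hy
    have hpoly : FP 0 g x = Polynomial.C (∑ j, g j) * PS y univ := by
      refine Polynomial.eq_of_degree_sub_lt_of_eval_index_eq univ (v := y) hym.injective.injOn ?_ ?_
      · rw [card_univ, Fintype.card_fin]
        have h1 : (FP 0 g x - Polynomial.C (∑ j, g j) * PS y univ).degree < (k+1 : ℕ) := by
          rw [← Polynomial.mem_degreeLT]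
          exact Submodule.sub_mem _ (Polynomial.mem_degreeLT.2 (FP_degree x g))
            (Polynomial.mem_degreeLT.2 (SP_degree _ y))
        rw [Polynomial.degree_lt_iff_coeff_zero] at h1 ⊢
        intro n hn
        rcases hn.eq_or_lt with rfl | h
        · rw [Polynomial.coeff_sub, FP_coeff, SP_coeff, sub_self]
        · exact h1 n h
      · intro i _
        rw [hy0, Polynomial.eval_mul, PS_eval, Finset.prod_eq_zero (mem_univ i) (sub_self _), mul_zero]
    refine ⟨Fin.snoc y (∑ j, g j), ⟨?_, ?_⟩, ?_⟩
    · simp only [Fin.snoc_last]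
      exact Finset.sum_pos (fun j _ => hg j) univ_nonempty
    · intro i; simpa using hy i
    · ext j
      have h1 := FP_nodes x g j
      have hd := den_ne hx.injective j
      rw [hpoly, Polynomial.eval_mul, Polynomial.eval_C] at h1
      simp only [Phi, Fin.snoc_last, Fin.snoc_castSucc]
      rw [h1]; field_simp

def Wo {k : ℕ} (x : Fin (k+1) → ℝ) : Set (Fin k → ℝ) :=
  {y | ∀ i : Fin k, x i.castSucc < y i ∧ y i < x i.succ}

/-- unnormalised density -/
noncomputable def bD {k : ℕ} (θ : ℝ) (x : Fin (k+1) → ℝ) (y : Fin k → ℝ) : ℝ :=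
  VD x ^ (1 - 2 * θ) * VD y * ∏ i : Fin k, ∏ j : Fin (k+1), |y i - x j| ^ (θ - 1)

lemma rho_Phi {k : ℕ} {θ : ℝ} {x : Fin (k+1) → ℝ} (hx : StrictMono x) {z : Fin (k+1) → ℝ} (hz : z ∈ Dz x) :
    rho θ (Phi x z) = Real.exp (-(z (Fin.last k))) * (z (Fin.last k)) ^ ((k+1) * (θ - 1)) *
      ((VD x ^ 2) ^ (-(θ - 1)) * ∏ i : Fin k, ∏ j : Fin (k+1), |z i.castSucc - x j| ^ (θ - 1)) := by
  rw [rho, Finset.prod_mul_distrib, ← Real.exp_sum, Finset.sum_neg_distrib, Phi_sum hx.injective,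
    mul_assoc]
  congr 1
  rw [Real.finsetProd_rpow _ _ (fun j _ => (Phi_pos hx hz j).le)]
  have h1 : ∏ j, Phi x z j = (z (Fin.last k)) ^ (k+1) * ((VD x ^ 2)⁻¹ * ∏ i : Fin k, ∏ j : Fin (k+1), |z i.castSucc - x j|) := by
    rw [← abs_of_pos (Finset.prod_pos fun j _ => Phi_pos hx hz j)]
    simp_rw [Phi]
    rw [Finset.prod_mul_distrib, Finset.prod_mul_distrib, abs_mul, abs_mul, Finset.prod_inv_distrib,
      abs_inv, den_abs, prod_const, card_univ, Fintype.card_fin, abs_pow, abs_of_pos hz.1]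
    have : |∏ j, (PS (fun i : Fin k => z i.castSucc) univ).eval (x j)| =
        ∏ i : Fin k, ∏ j : Fin (k+1), |z i.castSucc - x j| := by
      rw [Finset.prod_comm, Finset.abs_prod]
      refine Finset.prod_congr rfl fun j _ => ?_
      rw [PS_eval, Finset.abs_prod]
      exact Finset.prod_congr rfl fun i _ => abs_sub_comm _ _
    rw [this]; ring
  have hp : 0 ≤ ∏ i : Fin k, ∏ j : Fin (k+1), |z i.castSucc - x j| :=
    Finset.prod_nonneg fun i _ => Finset.prod_nonneg fun j _ => abs_nonneg _
  rw [h1, Real.mul_rpow (pow_nonneg hz.1.le _) (by positivity), Real.mul_rpow (by positivity) hp,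
    ← Real.rpow_natCast, ← Real.rpow_mul hz.1.le, Real.inv_rpow (by positivity), Real.rpow_neg (by positivity)]
  push_cast
  congr 2
  rw [← Real.finsetProd_rpow _ _ (fun i _ => Finset.prod_nonneg fun j _ => abs_nonneg _)]
  refine Finset.prod_congr rfl fun i _ => ?_
  rw [← Real.finsetProd_rpow _ _ (fun i _ => abs_nonneg _)]

lemma Dz_meas {k : ℕ} (x : Fin (k+1) → ℝ) : MeasurableSet (Dz x) := by
  have : Dz x = {z | 0 < z (Fin.last k)} ∩ ⋂ i : Fin k, ({z | x i.castSucc < z i.castSucc} ∩ {z | z i.castSucc < x i.succ}) := by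
    ext z; simp [Dz]
  rw [this]
  refine MeasurableSet.inter (measurableSet_lt measurable_const (measurable_pi_apply _)) ?_
  refine MeasurableSet.iInter fun i => MeasurableSet.inter ?_ ?_
  · exact measurableSet_lt measurable_const (measurable_pi_apply _)
  · exact measurableSet_lt (measurable_pi_apply _) measurable_const

lemma split_int {k : ℕ} (x : Fin (k+1) → ℝ) (a : ℝ → ℝ) (b : (Fin k → ℝ) → ℝ) :
    ∫ z in Dz x, a (z (Fin.last k)) * b (fun i => z i.castSucc) =
      (∫ s in Set.Ioi 0, a s) * ∫ y in Wo x, b y := by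
  have hmp := volume_preserving_piFinSuccAbove (fun _ : Fin (k+1) => ℝ) (Fin.last k)
  have hpre : Dz x = (MeasurableEquiv.piFinSuccAbove (fun _ : Fin (k+1) => ℝ) (Fin.last k)) ⁻¹'
      (Set.Ioi (0:ℝ) ×ˢ Wo x) := by
    ext z
    simp [Dz, Wo, MeasurableEquiv.piFinSuccAbove]
    intro _; rfl
  have h := hmp.setIntegral_preimage_emb (MeasurableEquiv.measurableEmbedding _)
    (fun p : ℝ × (Fin k → ℝ) => a p.1 * b p.2) (Set.Ioi (0:ℝ) ×ˢ Wo x)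
  rw [← hpre] at h
  rw [← setIntegral_prod_mul, ← Measure.volume_eq_prod, ← h]
  congr 1
  ext z
  simp [MeasurableEquiv.piFinSuccAbove]
  left; rfl

lemma KEY {k : ℕ} {θ : ℝ} (hθ : 0 < θ) {x : Fin (k+1) → ℝ} (hx : StrictMono x) (n : ℕ)
    (G : Polynomial ℝ → ℝ) (hG : ∀ (s : ℝ) (q : Polynomial ℝ), G (Polynomial.C s * q) = s ^ n * G q) :
    ∫ g in Orth (k+1), rho θ g * G (FP 0 g x) =
      Real.Gamma ((k+1) * θ + n) * ∫ y in Wo x, bD θ x y * G (PS y univ) := by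
  rw [← Phi_image hx, integral_image_eq_integral_abs_det_fderiv_smul volume (Dz_meas x)
    (fun z _ => (Phi_hasFDerivAt x z).hasFDerivWithinAt) (Phi_injOn hx)]
  have h1 : ∀ z ∈ Dz x, |(LinearMap.toContinuousLinearMap (Matrix.toLin' (JM x z))).det| •
      (rho θ (Phi x z) * G (FP 0 (Phi x z) x)) =
      (Real.exp (-(z (Fin.last k))) * (z (Fin.last k)) ^ ((k+1) * θ + n - 1)) *
       (fun y : Fin k → ℝ => bD θ x y * G (PS y univ)) (fun i => z i.castSucc) := by
    intro z hz
    have hdet : (LinearMap.toContinuousLinearMap (Matrix.toLin' (JM x z))).det = (JM x z).det := by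
      rw [LinearMap.det_toContinuousLinearMap, LinearMap.det_toLin']
    have hs := hz.1
    have hV := VD_pos hx
    rw [hdet, JM_det hx z hz.1 (interl_strictMono hx hz.2), rho_Phi hx hz, FP_Phi hx.injective, hG, smul_eq_mul]
    have e1 : (z (Fin.last k)) ^ (((k:ℝ)+1) * θ + n - 1) =
        (z (Fin.last k)) ^ (((k:ℝ)+1) * (θ-1)) * (z (Fin.last k)) ^ k * (z (Fin.last k)) ^ n := by
      rw [← Real.rpow_natCast, ← Real.rpow_natCast, ← Real.rpow_add hs, ← Real.rpow_add hs]
      congr 1; ring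
    have e2 : VD x ^ (1 - 2 * θ) = (VD x)⁻¹ * (VD x ^ 2) ^ (-(θ-1)) := by
      rw [← Real.rpow_natCast, ← Real.rpow_mul hV.le, ← Real.rpow_neg_one, ← Real.rpow_add hV]
      congr 1; push_cast; ring
    rw [e1]
    simp only [bD]
    rw [e2]; ring
  rw [setIntegral_congr_fun (Dz_meas x) h1]
  rw [split_int x (fun s => Real.exp (-s) * s ^ (((k:ℝ)+1) * θ + n - 1)) (fun y => bD θ x y * G (PS y univ)),
    Real.Gamma_eq_integral (by positivity)]

lemma DA_eq {k : ℕ} {β : ℝ} {x : Fin (k+1) → ℝ} (hx : StrictMono x) (y : Fin k → ℝ) :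
    DAdensity k β x y = (Real.Gamma (β * (k + 1) / 2) / Real.Gamma (β / 2) ^ (k + 1)) * bD (β/2) x y := by
  have : (∏ i : Fin (k + 1), ∏ j ∈ Ioi i, (x j - x i) ^ (1 - β)) = VD x ^ (1 - 2 * (β/2)) := by
    rw [VD, show 1 - 2 * (β/2) = 1 - β by ring, ← Real.finsetProd_rpow]
    · refine Finset.prod_congr rfl fun i _ => ?_
      rw [Real.finsetProd_rpow]
      exact fun j hj => (sub_pos.2 (hx (Finset.mem_Ioi.1 hj))).le
    · exact fun i _ => Finset.prod_nonneg fun j hj => (sub_pos.2 (hx (Finset.mem_Ioi.1 hj))).le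
  rw [DAdensity, this, bD]; simp only [VD]; ring

lemma DAdomain_eq {k : ℕ} (x : Fin (k+1) → ℝ) :
    DAdomain k x = Set.Icc (fun i : Fin k => x i.castSucc) (fun i => x i.succ) := by
  ext y; simp [DAdomain, Pi.le_def, forall_and]

lemma Wo_eq {k : ℕ} (x : Fin (k+1) → ℝ) :
    Wo x = Set.pi Set.univ fun i : Fin k => Set.Ioo (x i.castSucc) (x i.succ) := by
  ext y; simp [Wo]

lemma W_ae {k : ℕ} (x : Fin (k+1) → ℝ) : (Wo x : Set (Fin k → ℝ)) =ᵐ[volume] DAdomain k x := by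
  rw [Wo_eq, DAdomain_eq]
  exact Measure.univ_pi_Ioo_ae_eq_Icc

lemma Wo_meas {k : ℕ} (x : Fin (k+1) → ℝ) : MeasurableSet (Wo x) := by
  rw [Wo_eq]; exact MeasurableSet.univ_pi fun _ => measurableSet_Ioo

lemma bD_int {k : ℕ} {θ : ℝ} (hθ : 0 < θ) {x : Fin (k+1) → ℝ} (hx : StrictMono x) :
    IntegrableOn (bD θ x) (Wo x) := by
  have h := KEY hθ hx 0 (fun _ => 1) (by simp)
  have h2 := mon_val (m := k+1) hθ 0
  simp only [MvPolynomial.monomial_zero', map_one, MvPolynomial.eval_C] at h2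
  rw [h2] at h
  by_contra hn
  have : ∫ y in Wo x, bD θ x y * 1 = 0 := by
    simp only [mul_one]
    exact integral_undef hn
  rw [this, mul_zero] at h
  refine absurd h (Finset.prod_pos fun j _ => Real.Gamma_pos_of_pos ?_).ne'
  simpa using hθ

lemma DA_int {k : ℕ} {β : ℝ} (hβ : 0 < β) {x : Fin (k+1) → ℝ} (hx : StrictMono x)
    (f : (Fin k → ℝ) → ℝ) (hf : Continuous f) :
    IntegrableOn (fun y => DAdensity k β x y * f y) (DAdomain k x) := by
  have h1 : IntegrableOn (DAdensity k β x) (DAdomain k x) := by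
    rw [← integrableOn_congr_set_ae (W_ae x)]
    rw [show DAdensity k β x = _ from funext fun y => DA_eq hx y]
    exact (bD_int (half_pos hβ) hx).const_mul _
  have hc : IsCompact (DAdomain k x) := by rw [DAdomain_eq]; exact isCompact_Icc
  exact h1.mul_continuousOn hf.continuousOn hc

/-- The Dixon-Anderson integral as a Gamma expectation -/
lemma DA_KEY {k : ℕ} {β : ℝ} (hβ : 0 < β) {x : Fin (k+1) → ℝ} (hx : StrictMono x) (n : ℕ)
    (G : Polynomial ℝ → ℝ) (hG : ∀ (s : ℝ) (q : Polynomial ℝ), G (Polynomial.C s * q) = s ^ n * G q) :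
    ∫ y in DAdomain k x, DAdensity k β x y * G (PS y univ) =
      (Real.Gamma (β * (k + 1) / 2) / Real.Gamma (β / 2) ^ (k + 1) / Real.Gamma ((k+1) * (β/2) + n)) *
      ∫ g in Orth (k+1), rho (β/2) g * G (FP 0 g x) := by
  rw [KEY (half_pos hβ) hx n G hG, ← setIntegral_congr_set (W_ae x)]
  simp_rw [DA_eq hx, mul_assoc]
  rw [integral_const_mul]
  have : Real.Gamma ((k+1) * (β/2) + n) ≠ 0 := (Real.Gamma_pos_of_pos (by positivity)).ne'
  field_simp

noncomputable def gen {k : ℕ} (B : Finset ℝ) (y : Fin k → ℝ) : ℝ := ∏ w ∈ B, (PS y univ).eval w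

lemma gen_coeff {k : ℕ} (n : ℕ) (f : (Fin k → ℝ) → ℝ)
    (hf : f ∈ Submodule.span ℝ (Set.range (gen (k := k)))) :
    (fun y => f y * (PS y univ).coeff n) ∈ Submodule.span ℝ (Set.range (gen (k := k))) := by
  induction hf using Submodule.span_induction with
  | mem f hf =>
    obtain ⟨B, rfl⟩ := hf
    obtain ⟨t, htB, htc⟩ := (Set.Infinite.exists_subset_card_eq (s := ((B : Set ℝ)ᶜ)) (Set.Finite.infinite_compl B.finite_toSet) (k+1))
    have h1 : ∀ y : Fin k → ℝ, (PS y univ).coeff n =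
        ∑ v ∈ t, (PS y univ).eval v * (Lagrange.basis t id v).coeff n := by
      intro y
      have h := Lagrange.eq_interpolate (s := t) (v := id) (f := PS y univ) (Function.injective_id.injOn) (by
        rw [htc, (Polynomial.degree_eq_natDegree (PS_monic y univ).ne_zero), PS_natDegree]
        simp; exact_mod_cast Nat.lt_succ_self k)
      conv_lhs => rw [h]
      rw [Lagrange.interpolate_apply, Polynomial.finsetSum_coeff]
      simp
    have h2 : (fun y => gen B y * (PS y univ).coeff n) =
        ∑ v ∈ t, (Lagrange.basis t id v).coeff n • gen (k := k) (insert v B) := by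
      ext y
      rw [h1, Finset.mul_sum, Finset.sum_apply]
      refine Finset.sum_congr rfl fun v hv => ?_
      have hvB : v ∉ B := htB hv
      rw [Pi.smul_apply, gen, gen, Finset.prod_insert hvB, smul_eq_mul]; ring
    rw [h2]
    exact Submodule.sum_mem _ fun v _ => Submodule.smul_mem _ _ (Submodule.subset_span ⟨_, rfl⟩)
  | zero => 
    have : (fun y : Fin k → ℝ => (0 : (Fin k → ℝ) → ℝ) y * (PS y univ).coeff n) = 0 := by ext y; simp
    rw [this]; exact Submodule.zero_mem _
  | add f g _ _ hf hg =>
    convert Submodule.add_mem _ hf hg using 1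
    ext y; simp [add_mul]
  | smul a f _ hf =>
    convert Submodule.smul_mem _ a hf using 1
    ext y; simp [mul_assoc]

lemma esymm_coeff {k : ℕ} (y : Fin k → ℝ) (i : Fin k) :
    MvPolynomial.eval y (MvPolynomial.esymm (Fin k) ℝ (i+1)) =
      (-1)^((i:ℕ)+1) * (PS y univ).coeff (k - (i+1)) := by
  have h := MvPolynomial.aeval_esymm_eq_multiset_esymm (Fin k) ℝ (S := ℝ) (i+1) y
  rw [MvPolynomial.aeval_eq_eval] at h
  rw [show MvPolynomial.eval y (MvPolynomial.esymm (Fin k) ℝ (i+1)) = _ from h]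
  have h2 := Multiset.prod_X_sub_C_coeff (univ.val.map y) (k := k - (i+1)) (by simp)
  have h3 : PS y univ = ((univ.val.map y).map fun t => Polynomial.X - Polynomial.C t).prod := by
    rw [PS, Multiset.map_map]; rfl
  rw [h3, h2]
  have h4 : Multiset.card (univ.val.map y) - (k - ((i:ℕ)+1)) = i + 1 := by
    simp; omega
  rw [h4, ← mul_assoc, ← mul_pow]; simp

lemma sym_span {k : ℕ} (P : MvPolynomial (Fin k) ℝ) (hP : P.IsSymmetric) :
    (fun y => MvPolynomial.eval y P) ∈ Submodule.span ℝ (Set.range (gen (k := k))) := by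
  obtain ⟨p, hp⟩ := MvPolynomial.esymmAlgHom_fin_surjective ℝ (n := k) (m := k) le_rfl ⟨P, hP⟩
  have hp' : P = MvPolynomial.aeval (fun i : Fin k => MvPolynomial.esymm (Fin k) ℝ (i+1)) p := by
    rw [← MvPolynomial.esymmAlgHom_apply, hp]
  rw [hp']
  clear hp hp'
  induction p using MvPolynomial.induction_on with
  | C a =>
    have : (fun y : Fin k → ℝ => MvPolynomial.eval y (MvPolynomial.aeval (fun i : Fin k => MvPolynomial.esymm (Fin k) ℝ (i+1)) (MvPolynomial.C a))) = a • gen (k := k) ∅ := by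
      ext y; simp [gen]
    rw [this]
    exact Submodule.smul_mem _ _ (Submodule.subset_span ⟨_, rfl⟩)
  | add p q hp hq =>
    convert Submodule.add_mem _ hp hq using 1
    ext y; simp
  | mul_X p i hp =>
    have := Submodule.smul_mem _ ((-1)^((i:ℕ)+1) : ℝ) (gen_coeff (k - (i+1)) _ hp)
    convert this using 1
    ext y
    rw [map_mul, map_mul, MvPolynomial.aeval_X, esymm_coeff]
    simp only [Pi.smul_apply, smul_eq_mul]; ring

lemma PS_deriv_sum {m : ℕ} (y : Fin m → ℝ) (s : Finset (Fin m)) :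
    (PS y s).derivative = ∑ i ∈ s, PS y (s.erase i) := by
  rw [PS, Polynomial.derivative_prod_finset]
  refine Finset.sum_congr rfl fun i _ => ?_
  simp [PS]

lemma PS_cont {m : ℕ} (s : Finset (Fin m)) (w : ℝ) :
    Continuous (fun y : Fin m → ℝ => (PS y s).eval w) := (PS_contDiff s w).continuous

lemma PS_cont1 {m : ℕ} (s : Finset (Fin m)) (w : ℝ) :
    Continuous (fun y : Fin m → ℝ => (PS y s).derivative.eval w) := by
  simp_rw [PS_deriv_sum, Polynomial.eval_finsetSum]
  exact continuous_finsetSum _ fun i _ => PS_cont _ _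

lemma PS_cont2 {m : ℕ} (s : Finset (Fin m)) (w : ℝ) :
    Continuous (fun y : Fin m → ℝ => (PS y s).derivative.derivative.eval w) := by
  simp_rw [PS_deriv_sum, Polynomial.derivative_sum, Polynomial.eval_finsetSum]
  exact continuous_finsetSum _ fun i _ => PS_cont1 _ _

lemma GB_cont {m : ℕ} (θ : ℝ) (B : Finset ℝ) :
    Continuous (fun y : Fin m → ℝ => GB θ B (PS y univ)) := by
  unfold GB
  refine Continuous.add ?_ (continuous_const.mul ?_)
  · refine continuous_finsetSum _ fun w _ => ?_
    exact (continuous_const.mul (PS_cont2 _ _)).mul (continuous_finsetProd _ fun v _ => PS_cont _ _)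
  · refine continuous_finsetSum _ fun w _ => continuous_finsetSum _ fun v _ => ?_
    refine Continuous.mul ?_ (continuous_finsetProd _ fun v _ => PS_cont _ _)
    exact (((PS_cont _ _).mul (PS_cont1 _ _)).sub ((PS_cont1 _ _).mul (PS_cont _ _))).div_const _

lemma prod_hom (B : Finset ℝ) (s : ℝ) (q : Polynomial ℝ) :
    ∏ w ∈ B, (Polynomial.C s * q).eval w = s ^ B.card * ∏ w ∈ B, q.eval w := by
  simp [Finset.prod_mul_distrib]

lemma GB_hom (θ : ℝ) (B : Finset ℝ) (s : ℝ) (q : Polynomial ℝ) :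
    GB θ B (Polynomial.C s * q) = s ^ B.card * GB θ B q := by
  unfold GB
  rw [mul_add]
  congr 1
  · rw [Finset.mul_sum]
    refine Finset.sum_congr rfl fun w hw => ?_
    rw [prod_hom, ← Finset.card_erase_add_one hw, pow_succ]
    simp only [Polynomial.derivative_C_mul, Polynomial.eval_mul, Polynomial.eval_C]
    ring
  · rw [mul_left_comm (s ^ B.card)]
    congr 1
    rw [Finset.mul_sum]
    refine Finset.sum_congr rfl fun w hw => ?_
    rw [Finset.mul_sum]
    refine Finset.sum_congr rfl fun v hv => ?_
    rw [prod_hom, ← Finset.card_erase_add_one hw, ← Finset.card_erase_add_one hv, pow_succ, pow_succ]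
    simp only [Polynomial.derivative_C_mul, Polynomial.eval_mul, Polynomial.eval_C]
    ring

lemma gen_genA {k : ℕ} (θ : ℝ) (B : Finset ℝ) (y : Fin k → ℝ) (hy : Function.Injective y) :
    genA θ (gen B) y = GB θ B (PS y univ) := by
  have h := genA_FPprod θ 1 0 y B hy
  have e : ∀ x : Fin k → ℝ, FP 1 0 x = PS x univ := by intro x; simp [FP]
  simp only [e] at h
  have e2 : (gen B : (Fin k → ℝ) → ℝ) = fun x => ∏ w ∈ B, (PS x univ).eval w := rfl
  rw [e2]
  simpa using h

lemma gen_contDiff {k : ℕ} (B : Finset ℝ) : ContDiff ℝ 2 (gen (k := k) B) := by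
  unfold gen
  exact contDiff_prod fun w _ => PS_contDiff _ _

def Good {k : ℕ} (β : ℝ) (f : (Fin k → ℝ) → ℝ) : Prop :=
  ContDiff ℝ 2 f ∧ ∃ F : MvPolynomial (Fin (k+1)) ℝ, ∀ x : Fin (k+1) → ℝ, StrictMono x →
    MvPolynomial.eval x F = (∫ y in DAdomain k x, DAdensity k β x y * f y) ∧
    IntegrableOn (fun y => DAdensity k β x y * genA (β/2) f y) (DAdomain k x) ∧
    genA (β/2) (fun x => MvPolynomial.eval x F) x =
      ∫ y in DAdomain k x, DAdensity k β x y * genA (β/2) f y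

lemma eval_contDiff {m : ℕ} (F : MvPolynomial (Fin m) ℝ) :
    ContDiff ℝ 2 (fun x : Fin m → ℝ => MvPolynomial.eval x F) := by
  induction F using MvPolynomial.induction_on with
  | C a => simpa using contDiff_const
  | add p q hp hq => simpa using hp.add hq
  | mul_X p i hp => simpa using hp.mul (contDiff_apply ℝ ℝ i)

lemma Good_gen {k : ℕ} {β : ℝ} (hβ : 0 < β) (B : Finset ℝ) : Good β (gen (k := k) B) := by
  refine ⟨gen_contDiff B, MvPolynomial.C (Real.Gamma (β * (k + 1) / 2) / Real.Gamma (β / 2) ^ (k + 1) / Real.Gamma ((k+1) * (β/2) + B.card)) * fpoly (half_pos hβ) B, fun x hx => ⟨?_, ?_, ?_⟩⟩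
  · rw [map_mul, MvPolynomial.eval_C, fpoly_int]
    exact (DA_KEY hβ hx B.card (fun q => ∏ w ∈ B, q.eval w) (prod_hom B)).symm
  · have h := DA_int hβ hx _ (GB_cont (m := k) (β/2) B)
    rw [← integrableOn_congr_set_ae (W_ae x)] at h ⊢
    refine (integrableOn_congr_fun (fun y hy => ?_) (Wo_meas x)).2 h
    rw [gen_genA _ _ _ (interl_strictMono hx hy).injective]
  · simp only [map_mul, MvPolynomial.eval_C]
    rw [genA_const_mul _ _ _ (eval_contDiff _), fpoly_genA _ _ _ hx.injective,
      ← DA_KEY hβ hx B.card (GB (β/2) B) (GB_hom _ B)]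
    rw [← setIntegral_congr_set (W_ae x), ← setIntegral_congr_set (W_ae x)]
    refine setIntegral_congr_fun (Wo_meas x) fun y hy => ?_
    rw [gen_genA _ _ _ (interl_strictMono hx hy).injective]

lemma Good_span {k : ℕ} {β : ℝ} (hβ : 0 < β) (f : (Fin k → ℝ) → ℝ)
    (h : f ∈ Submodule.span ℝ (Set.range (gen (k := k)))) : Good β f := by
  induction h using Submodule.span_induction with
  | mem f hf => obtain ⟨B, rfl⟩ := hf; exact Good_gen hβ B
  | zero =>
    refine ⟨contDiff_const, 0, fun x hx => ?_⟩
    have h0 : ∀ m (z : Fin m → ℝ), genA (β/2) (fun _ => (0:ℝ)) z = 0 := fun m z => genA_const _ _ _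
    have h1 : genA (β/2) (0 : (Fin k → ℝ) → ℝ) = fun _ => 0 := funext fun z => h0 k z
    simp [h1, h0]
  | add f g _ _ hf hg =>
    obtain ⟨cf, F, hF⟩ := hf
    obtain ⟨cg, G, hG⟩ := hg
    refine ⟨cf.add cg, F + G, fun x hx => ?_⟩
    obtain ⟨f1, f2, f3⟩ := hF x hx
    obtain ⟨g1, g2, g3⟩ := hG x hx
    have e : ∀ y, genA (β/2) (f + g) y = genA (β/2) f y + genA (β/2) g y := fun y => genA_add _ _ _ cf cg y
    refine ⟨?_, ?_, ?_⟩
    · rw [map_add, f1, g1, ← integral_add (DA_int hβ hx _ cf.continuous) (DA_int hβ hx _ cg.continuous)]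
      simp [mul_add]
    · simp only [e, mul_add]
      exact f2.add g2
    · simp only [e, mul_add, map_add]
      rw [genA_add _ _ _ (eval_contDiff F) (eval_contDiff G), f3, g3, integral_add f2 g2]
  | smul a f _ hf =>
    obtain ⟨cf, F, hF⟩ := hf
    refine ⟨contDiff_const.smul cf, MvPolynomial.C a * F, fun x hx => ?_⟩
    obtain ⟨f1, f2, f3⟩ := hF x hx
    have e : ∀ y, genA (β/2) (a • f) y = a * genA (β/2) f y := fun y => genA_const_mul _ _ _ cf y
    refine ⟨?_, ?_, ?_⟩
    · rw [map_mul, MvPolynomial.eval_C, f1, ← integral_const_mul]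
      congr 1; ext y; simp; ring
    · simp only [e, mul_left_comm _ a]
      exact f2.const_mul a
    · simp only [e, mul_left_comm _ a, map_mul, MvPolynomial.eval_C]
      rw [genA_const_mul _ _ _ (eval_contDiff F), f3, integral_const_mul]

lemma Good_sym {k : ℕ} {β : ℝ} (hβ : 0 < β) (P : MvPolynomial (Fin k) ℝ) (hP : P.IsSymmetric) :
    Good β (fun y => MvPolynomial.eval y P) := Good_span hβ _ (sym_span P hP)

lemma sep_strict {m : ℕ} (F : MvPolynomial (Fin m) ℝ)
    (h : ∀ x : {x : Fin m → ℝ // StrictMono x}, MvPolynomial.eval x.1 F = 0) : F = 0 := by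
  refine MvPolynomial.funext_set (fun i : Fin m => Set.Ioo (i : ℝ) ((i : ℝ) + 1))
    (fun i => Set.Ioo_infinite (by linarith)) fun x hx => ?_
  rw [map_zero]
  refine h ⟨x, fun i j hij => ?_⟩
  have h1 := hx i (Set.mem_univ _)
  have h2 := hx j (Set.mem_univ _)
  have h3 : (i : ℝ) + 1 ≤ (j : ℝ) := by exact_mod_cast hij
  exact lt_of_lt_of_le h1.2 (h3.trans h2.1.le)

noncomputable def evL {m : ℕ} (x : Fin m → ℝ) : MvPolynomial (Fin m) ℝ →ₗ[ℝ] ℝ where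
  toFun F := MvPolynomial.eval x F
  map_add' := by simp
  map_smul' := by simp

noncomputable def genL {m : ℕ} (θ : ℝ) (x : Fin m → ℝ) : MvPolynomial (Fin m) ℝ →ₗ[ℝ] ℝ where
  toFun F := genA θ (fun x => MvPolynomial.eval x F) x
  map_add' F G := by
    simp only [map_add]
    exact genA_add _ _ _ (eval_contDiff F) (eval_contDiff G) x
  map_smul' a F := by
    simp only [MvPolynomial.smul_eval, RingHom.id_apply, smul_eq_mul]
    exact genA_const_mul _ _ _ (eval_contDiff F) x

lemma interp_sym (k d : ℕ) : ∃ (s : Finset {z : Fin k → ℝ // StrictMono z})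
    (L : {z : Fin k → ℝ // StrictMono z} → MvPolynomial (Fin k) ℝ), (∀ a, (L a).IsSymmetric) ∧
    ∀ p : MvPolynomial (Fin k) ℝ, p.IsSymmetric → p.totalDegree ≤ d →
      p = ∑ a ∈ s, MvPolynomial.eval a.1 p • L a := by
  let M : Submodule ℝ (MvPolynomial (Fin k) ℝ) := MvPolynomial.restrictTotalDegree (Fin k) ℝ d ⊓
    (MvPolynomial.symmetricSubalgebra (Fin k) ℝ).toSubmodule
  haveI : FiniteDimensional ℝ M := Submodule.finiteDimensional_inf_left _ _
  obtain ⟨s, L, hL⟩ := fd_interp (M := M) (fun z : {z : Fin k → ℝ // StrictMono z} =>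
    (evL z.1).comp M.subtype) (fun m hm => Subtype.ext (sep_strict m.1 hm))
  refine ⟨s, fun a => (L a).1, fun a => (L a).2.2, fun p hp hd => ?_⟩
  have := congrArg Subtype.val (hL ⟨p, (MvPolynomial.mem_restrictTotalDegree _ _ _).2 hd, hp⟩)
  rw [AddSubmonoidClass.coe_finsetSum] at this
  exact this

lemma main_aux (β : ℝ) (hβ : 0 < β) (k d : ℕ)
    (u : ℝ → (Fin k → ℝ) → ℝ) (v : ℝ → (Fin (k + 1) → ℝ) → ℝ)
    (hu_poly : ∀ t : ℝ, 0 ≤ t → ∃ Pt : MvPolynomial (Fin k) ℝ, Pt.IsSymmetric ∧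
      Pt.totalDegree ≤ d ∧ ∀ z, u t z = MvPolynomial.eval z Pt)
    (hu_eq : ∀ t : ℝ, 0 ≤ t → ∀ z : Fin k → ℝ, Function.Injective z →
      HasDerivWithinAt (fun s => u s z) (genA (β / 2) (u t) z) (Set.Ici 0) t)
    (hv_poly : ∀ t : ℝ, 0 ≤ t → ∃ Qt : MvPolynomial (Fin (k + 1)) ℝ,
      Qt.totalDegree ≤ d ∧ ∀ x, v t x = MvPolynomial.eval x Qt)
    (hv_init : ∀ x : Fin (k + 1) → ℝ, StrictMono x →
      v 0 x = ∫ y in DAdomain k x, DAdensity k β x y * u 0 y)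
    (hv_eq : ∀ t : ℝ, 0 ≤ t → ∀ x : Fin (k + 1) → ℝ, Function.Injective x →
      HasDerivWithinAt (fun s => v s x) (genA (β / 2) (v t) x) (Set.Ici 0) t) :
    ∀ t : ℝ, 0 ≤ t → ∀ x : Fin (k + 1) → ℝ, StrictMono x →
      (∫ y in DAdomain k x, DAdensity k β x y * u t y) = v t x := by
  obtain ⟨S, L, hLs, hL⟩ := interp_sym k d
  have hu : ∀ t : ℝ, 0 ≤ t → u t = fun z => ∑ a ∈ S, u t a.1 * MvPolynomial.eval z (L a) := by
    intro t ht
    obtain ⟨p, hp, hd, hpe⟩ := hu_poly t ht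
    funext z
    have := congrArg (MvPolynomial.eval z) (hL p hp hd)
    rw [map_sum] at this
    simpa only [MvPolynomial.smul_eval, ← hpe] using this
  have hcd : ∀ a ∈ S, ContDiff ℝ 2 (fun z => MvPolynomial.eval z (L a)) :=
    fun a _ => eval_contDiff (L a)
  have hgu1 : ∀ t : ℝ, 0 ≤ t → ∀ z, genA (β/2) (u t) z =
      ∑ a ∈ S, u t a.1 * genA (β/2) (fun z => MvPolynomial.eval z (L a)) z := by
    intro t ht z
    have := genA_sum (β/2) S (fun a => u t a.1) (fun a z => MvPolynomial.eval z (L a)) hcd z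
    rw [← this, ← hu t ht]
  have hgu2 : ∀ t : ℝ, 0 ≤ t → ∀ z, Function.Injective z → genA (β/2) (u t) z =
      ∑ a ∈ S, genA (β/2) (u t) a.1 * MvPolynomial.eval z (L a) := by
    intro t ht z hz
    have h1 := hu_eq t ht z hz
    have h2 : HasDerivWithinAt (fun s => ∑ a ∈ S, u s a.1 * MvPolynomial.eval z (L a))
        (∑ a ∈ S, genA (β/2) (u t) a.1 * MvPolynomial.eval z (L a)) (Set.Ici 0) t :=
      HasDerivWithinAt.fun_sum fun a _ => (hu_eq t ht a.1 a.2.injective).mul_const _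
    have h3 : HasDerivWithinAt (fun s => u s z)
        (∑ a ∈ S, genA (β/2) (u t) a.1 * MvPolynomial.eval z (L a)) (Set.Ici 0) t :=
      h2.congr (fun s hs => congrFun (hu s hs) z) (congrFun (hu t ht) z)
    exact (uniqueDiffOn_Ici 0 t ht).eq_deriv _ h1 h3
  have hG : ∀ a, ∃ F : MvPolynomial (Fin (k+1)) ℝ, ∀ x : Fin (k+1) → ℝ, StrictMono x →
    MvPolynomial.eval x F = (∫ y in DAdomain k x, DAdensity k β x y * MvPolynomial.eval y (L a)) ∧
    IntegrableOn (fun y => DAdensity k β x y * genA (β/2) (fun z => MvPolynomial.eval z (L a)) y)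
      (DAdomain k x) ∧
    genA (β/2) (fun x => MvPolynomial.eval x F) x =
      ∫ y in DAdomain k x, DAdensity k β x y * genA (β/2) (fun z => MvPolynomial.eval z (L a)) y :=
    fun a => (Good_sym hβ (L a) (hLs a)).2
  choose F hF using hG
  choose! Q hQd hQ using hv_poly
  -- general integral of linear combination
  have hint : ∀ (c : {z : Fin k → ℝ // StrictMono z} → ℝ) (x : Fin (k+1) → ℝ), StrictMono x →
      (∫ y in DAdomain k x, DAdensity k β x y * ∑ a ∈ S, c a * MvPolynomial.eval y (L a)) =
      ∑ a ∈ S, c a * MvPolynomial.eval x (F a) := by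
    intro c x hx
    simp_rw [Finset.mul_sum, mul_left_comm _ (c _)]
    rw [integral_finsetSum]
    · refine Finset.sum_congr rfl fun a _ => ?_
      rw [integral_const_mul, (hF a x hx).1]
    · intro a ha
      exact (DA_int hβ hx _ (hcd a ha).continuous).const_mul _
  have hintG : ∀ t : ℝ, 0 ≤ t → ∀ x : Fin (k+1) → ℝ, StrictMono x →
      (∫ y in DAdomain k x, DAdensity k β x y * genA (β/2) (u t) y) =
      ∑ a ∈ S, u t a.1 * genA (β/2) (fun x => MvPolynomial.eval x (F a)) x := by
    intro t ht x hx
    simp_rw [hgu1 t ht, Finset.mul_sum, mul_left_comm _ (u t _)]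
    rw [integral_finsetSum]
    · refine Finset.sum_congr rfl fun a _ => ?_
      rw [integral_const_mul, (hF a x hx).2.2]
    · intro a ha
      exact (hF a x hx).2.1.const_mul _
  have hkey : ∀ t : ℝ, 0 ≤ t → ∀ x : Fin (k+1) → ℝ, StrictMono x →
      ∑ a ∈ S, genA (β/2) (u t) a.1 * MvPolynomial.eval x (F a) =
      ∑ a ∈ S, u t a.1 * genA (β/2) (fun x => MvPolynomial.eval x (F a)) x := by
    intro t ht x hx
    rw [← hintG t ht x hx, ← hint _ x hx]
    rw [← setIntegral_congr_set (W_ae x), ← setIntegral_congr_set (W_ae x)]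
    refine setIntegral_congr_fun (Wo_meas x) fun y hy => ?_
    beta_reduce
    rw [hgu2 t ht y (interl_strictMono hx hy).injective]
  let D : ℕ := max d (S.sup fun a => (F a).totalDegree)
  let E : Submodule ℝ (MvPolynomial (Fin (k+1)) ℝ) :=
    MvPolynomial.restrictTotalDegree (Fin (k+1)) ℝ D
  have hmem : ∀ t : ℝ, (∑ a ∈ S, u t a.1 • F a) - Q (max t 0) ∈ E := by
    intro t
    refine E.sub_mem (E.sum_mem fun a ha => E.smul_mem _ ?_) ?_
    · exact (MvPolynomial.mem_restrictTotalDegree _ _ _).2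
        ((Finset.le_sup (f := fun a => (F a).totalDegree) ha).trans (le_max_right _ _))
    · exact (MvPolynomial.mem_restrictTotalDegree _ _ _).2
        ((hQd _ (le_max_right _ _)).trans (le_max_left _ _))
  have hev : ∀ (t : ℝ), 0 ≤ t → ∀ x,
      MvPolynomial.eval x ((∑ a ∈ S, u t a.1 • F a) - Q (max t 0)) =
      (∑ a ∈ S, u t a.1 * MvPolynomial.eval x (F a)) - v t x := by
    intro t ht x
    rw [map_sub, map_sum, max_eq_left ht, ← hQ t ht]
    simp only [MvPolynomial.smul_eval]
  have hIu : ∀ t : ℝ, 0 ≤ t → ∀ x : Fin (k+1) → ℝ, StrictMono x →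
      (∫ y in DAdomain k x, DAdensity k β x y * u t y) =
      ∑ a ∈ S, u t a.1 * MvPolynomial.eval x (F a) := by
    intro t ht x hx
    rw [← hint _ x hx]
    congr 1
    funext y
    rw [← congrFun (hu t ht) y]
  have hzero := ode_zero (E := E) (X := {x : Fin (k+1) → ℝ // StrictMono x})
    (fun x => (evL x.1).comp E.subtype) (fun x => (genL (β/2) x.1).comp E.subtype)
    (fun m hm => Subtype.ext (sep_strict m.1 hm))
    (fun t => ⟨_, hmem t⟩)
    (by
      refine Subtype.ext (sep_strict _ fun x => ?_)
      rw [hev 0 le_rfl, hv_init x.1 x.2, hIu 0 le_rfl x.1 x.2, sub_self])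
    (by
      intro x t ht
      have h1 : HasDerivWithinAt
          (fun s => (∑ a ∈ S, u s a.1 * MvPolynomial.eval x.1 (F a)) - v s x.1)
          ((∑ a ∈ S, genA (β/2) (u t) a.1 * MvPolynomial.eval x.1 (F a)) -
            genA (β/2) (v t) x.1) (Set.Ici 0) t :=
        (HasDerivWithinAt.fun_sum fun a _ => (hu_eq t ht a.1 a.2.injective).mul_const _).sub
          (hv_eq t ht x.1 x.2.injective)
      have h2 : genL (β/2) x.1 ((∑ a ∈ S, u t a.1 • F a) - Q (max t 0)) =
          (∑ a ∈ S, genA (β/2) (u t) a.1 * MvPolynomial.eval x.1 (F a)) -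
            genA (β/2) (v t) x.1 := by
        rw [map_sub, map_sum, max_eq_left ht, hkey t ht x.1 x.2]
        have e : v t = fun x => MvPolynomial.eval x (Q t) := funext (hQ t ht)
        rw [e]
        simp only [map_smul, smul_eq_mul]
        rfl
      rw [← h2] at h1
      exact h1.congr (fun s hs => hev s hs x.1) (hev t ht x.1))
  intro t ht x hx
  have h1 := congrArg (fun e : E => MvPolynomial.eval x e.1) (hzero t ht)
  beta_reduce at h1
  rw [hev t ht x] at h1
  rw [hIu t ht x hx]
  have h2 : MvPolynomial.eval x ((0 : E) : MvPolynomial (Fin (k+1)) ℝ) = 0 := by simp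
  linarith

/-- Intertwining of the `β`-Dyson Brownian motion semigroups `P^{(k)}` and `P^{(k+1)}` by the
Dixon–Anderson kernel, expressed through their action on symmetric-polynomial solutions of
the Kolmogorov backward equation: if `u` solves `∂u/∂t = A^{(k)}u` with `u(0,·) = p`, and
`v` solves `∂v/∂t = A^{(k+1)}v` with `v(0,x) = ∫_{W^{(k)}(x)} Λ^{(k)}(x,y) p(y) dy`, both
remaining symmetric polynomials of total degree at most `deg p` in the space variables with
continuously differentiable time dependence, then
`∫_{W^{(k)}(x)} Λ^{(k)}(x,y) u(t,y) dy = v(t,x)` for all `t ≥ 0` and strictly increasing `x`. -/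
theorem DA_intertwines_semigroups (β : ℝ) (hβ : 0 < β) (k : ℕ) (hk : 1 ≤ k)
    (P : MvPolynomial (Fin k) ℝ) (hP : P.IsSymmetric)
    (u : ℝ → (Fin k → ℝ) → ℝ) (v : ℝ → (Fin (k + 1) → ℝ) → ℝ)
    (hu_poly : ∀ t : ℝ, 0 ≤ t → ∃ Pt : MvPolynomial (Fin k) ℝ, Pt.IsSymmetric ∧
      Pt.totalDegree ≤ P.totalDegree ∧ ∀ z, u t z = MvPolynomial.eval z Pt)
    (hu_C1 : ∀ z, ContDiffOn ℝ 1 (fun t => u t z) (Set.Ici 0))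
    (hu_init : ∀ z, u 0 z = MvPolynomial.eval z P)
    (hu_eq : ∀ t : ℝ, 0 ≤ t → ∀ z : Fin k → ℝ, Function.Injective z →
      HasDerivWithinAt (fun s => u s z) (genA (β / 2) (u t) z) (Set.Ici 0) t)
    (hv_poly : ∀ t : ℝ, 0 ≤ t → ∃ Qt : MvPolynomial (Fin (k + 1)) ℝ, Qt.IsSymmetric ∧
      Qt.totalDegree ≤ P.totalDegree ∧ ∀ x, v t x = MvPolynomial.eval x Qt)
    (hv_C1 : ∀ x, ContDiffOn ℝ 1 (fun t => v t x) (Set.Ici 0))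
    (hv_init : ∀ x : Fin (k + 1) → ℝ, StrictMono x →
      v 0 x = ∫ y in DAdomain k x, DAdensity k β x y * MvPolynomial.eval y P)
    (hv_eq : ∀ t : ℝ, 0 ≤ t → ∀ x : Fin (k + 1) → ℝ, Function.Injective x →
      HasDerivWithinAt (fun s => v s x) (genA (β / 2) (v t) x) (Set.Ici 0) t) :
    ∀ t : ℝ, 0 ≤ t → ∀ x : Fin (k + 1) → ℝ, StrictMono x →
      (∫ y in DAdomain k x, DAdensity k β x y * u t y) = v t x := by
  exact main_aux β hβ k P.totalDegree u v hu_poly hu_eq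
    (fun t ht => by
      obtain ⟨Q, _, h⟩ := hv_poly t ht
      exact ⟨Q, h⟩)
    (fun x hx => by
      simp_rw [hu_init]
      exact hv_init x hx) hv_eq
end
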